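/- arXiv:1811.05870 — 4 statements merged into one kernel-verified Lean document; each statement's English description precedes it below -/
import Mathlib

section
/- Let F be a field, G an abelian group, and U = UT(n_1,…,n_s) ⊆ M_n(F). The assignment sending an admissible (Z×G)-grading on M_n(F) to the G-grading on U obtained by restriction to U followed by coarsening along the projection Z×G → G yields a bijection between the set of admissible isomorphism classes of (Z×G)-gradings on M_n(F) and the set of isomorphism classes of G-gradings on the associative algebra U. -/
open Matrix
set_option synthInstance.maxHeartbeats 1000000
set_option maxHeartbeats 1000000

structure AlgGrading (F : Type*) [CommRing F] (A : Type*) [Ring A] [Algebra F A]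
    (G : Type*) [Group G] where
  comp : G → Submodule F A
  indep : ∀ g : G, Disjoint (comp g) (⨆ h : G, ⨆ _ : h ≠ g, comp h)
  total : (⨆ g : G, comp g) = ⊤
  mul_mem : ∀ g h : G, ∀ x ∈ comp g, ∀ y ∈ comp h, x * y ∈ comp (g * h)

structure LieGrading (F : Type*) [CommRing F] (L : Type*) [LieRing L] [LieAlgebra F L]
    (G : Type*) [Group G] where
  comp : G → Submodule F L
  indep : ∀ g : G, Disjoint (comp g) (⨆ h : G, ⨆ _ : h ≠ g, comp h)
  total : (⨆ g : G, comp g) = ⊤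
  lie_mem : ∀ g h : G, ∀ x ∈ comp g, ∀ y ∈ comp h, ⁅x, y⁆ ∈ comp (g * h)

variable (F : Type*) [Field F] {n s : ℕ}

def UTB (b : Fin n → Fin s) : Subalgebra F (Matrix (Fin n) (Fin n) F) where
  carrier := {M | M.BlockTriangular b}
  mul_mem' := fun {M N} hM hN => hM.mul hN
  add_mem' := fun {M N} hM hN => hM.add hN
  algebraMap_mem' := fun c => by
    show (algebraMap F (Matrix (Fin n) (Fin n) F) c).BlockTriangular b
    rw [Matrix.algebraMap_eq_diagonal]
    exact Matrix.blockTriangular_diagonal _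

def Jdiag (b : Fin n → Fin s) (m : ℤ) : Submodule F (Matrix (Fin n) (Fin n) F) where
  carrier := {M | ∀ p q : Fin n, ((b q : ℤ) ≠ (b p : ℤ) + m) → M p q = 0}
  add_mem' := fun {M N} hM hN p q h => by
    simp [Matrix.add_apply, hM p q h, hN p q h]
  zero_mem' := fun p q h => rfl
  smul_mem' := fun c M hM p q h => by
    simp [Matrix.smul_apply, hM p q h]

def AlgGrading.IsGradedSubspace {F : Type*} [CommRing F] {A : Type*} [Ring A] [Algebra F A]
    {G : Type*} [Group G] (Γ : AlgGrading F A G) (V : Submodule F A) : Prop :=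
  V = ⨆ g : G, V ⊓ Γ.comp g

def LieGrading.IsGradedSubspace {F : Type*} [CommRing F] {L : Type*} [LieRing L]
    [LieAlgebra F L] {G : Type*} [Group G] (Γ : LieGrading F L G) (V : Submodule F L) : Prop :=
  V = ⨆ g : G, V ⊓ Γ.comp g

def AlgGrading.Iso {F : Type*} [CommRing F] {A : Type*} [Ring A] [Algebra F A]
    {G : Type*} [Group G] (Γ₁ Γ₂ : AlgGrading F A G) : Prop :=
  ∃ ψ : A ≃ₐ[F] A, ∀ g : G, (Γ₁.comp g).map ψ.toLinearMap = Γ₂.comp g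

def LieGrading.Iso {F : Type*} [CommRing F] {L : Type*} [LieRing L] [LieAlgebra F L]
    {G : Type*} [Group G] (Γ₁ Γ₂ : LieGrading F L G) : Prop :=
  ∃ ψ : L ≃ₗ⁅F⁆ L, ∀ g : G, (Γ₁.comp g).map ψ.toLinearEquiv.toLinearMap = Γ₂.comp g

/-- A `(ℤ×G)`-grading on `M_n(F)` is admissible if each `J_m`, `m ≥ 0`, is contained in the
degree-`m` component of the coarsening induced by the projection `ℤ×G → ℤ`. -/
def Admissible {F : Type*} [Field F] {G : Type*} [CommGroup G] {n s : ℕ}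
    (b : Fin n → Fin s)
    (Γ : AlgGrading F (Matrix (Fin n) (Fin n) F) (Multiplicative ℤ × G)) : Prop :=
  ∀ m : ℤ, 0 ≤ m → Jdiag F b m ≤ ⨆ g : G, Γ.comp (Multiplicative.ofAdd m, g)

/-- The degree-`g` component of the `G`-grading induced on `U` by a `(ℤ×G)`-grading on
`M_n(F)`: restrict to `U` and coarsen along the projection `ℤ×G → G`. -/
def inducedComp {F : Type*} [Field F] {G : Type*} [CommGroup G] {n s : ℕ}
    (b : Fin n → Fin s)
    (Γ : AlgGrading F (Matrix (Fin n) (Fin n) F) (Multiplicative ℤ × G)) (g : G) :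
    Submodule F ↥(UTB F b) :=
  (⨆ m : ℤ, Γ.comp (Multiplicative.ofAdd m, g)).comap (UTB F b).val.toLinearMap

section Projections

variable {F : Type*} [Field F] {A : Type*} [Ring A] [Algebra F A] {G : Type*} [Group G]

namespace AlgGrading

theorem isInternal [DecidableEq G] (Γ : AlgGrading F A G) : DirectSum.IsInternal Γ.comp :=
  (DirectSum.isInternal_submodule_iff_iSupIndep_and_iSup_eq_top _).2 ⟨Γ.indep, Γ.total⟩

open Classical in
/-- The projection onto the homogeneous component of degree `g`. -/
noncomputable def proj (Γ : AlgGrading F A G) (g : G) : A →ₗ[F] A :=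
  letI := Γ.isInternal.chooseDecomposition
  (Γ.comp g).subtype ∘ₗ (DirectSum.component F G (fun i => Γ.comp i) g) ∘ₗ
    (DirectSum.decomposeLinearEquiv Γ.comp).toLinearMap

variable (Γ : AlgGrading F A G)

theorem proj_mem (g : G) (x : A) : Γ.proj g x ∈ Γ.comp g := by
  classical
  simp [proj]

theorem proj_of_mem {g : G} {x : A} (hx : x ∈ Γ.comp g) : Γ.proj g x = x := by
  classical
  let := Γ.isInternal.chooseDecomposition
  exact DirectSum.decompose_of_mem_same Γ.comp hx

theorem proj_of_mem_ne {g h : G} {x : A} (hx : x ∈ Γ.comp g) (hgh : g ≠ h) :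
    Γ.proj h x = 0 := by
  classical
  let := Γ.isInternal.chooseDecomposition
  exact DirectSum.decompose_of_mem_ne Γ.comp hx hgh

theorem finite_support [FiniteDimensional F A] : {g | Γ.comp g ≠ ⊥}.Finite :=
  WellFoundedGT.finite_ne_bot_of_iSupIndep Γ.indep

/-- The degrees of the nonzero homogeneous components. -/
noncomputable def supp [FiniteDimensional F A] : Finset G := Γ.finite_support.toFinset

theorem proj_eq_zero_of_notMem_supp [FiniteDimensional F A] {g : G} (hg : g ∉ Γ.supp) (x : A) :
    Γ.proj g x = 0 := by
  have h : Γ.comp g = ⊥ := by simpa [supp] using hg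
  have := Γ.proj_mem g x
  rwa [h, Submodule.mem_bot] at this

theorem sum_proj [FiniteDimensional F A] (x : A) : ∑ g ∈ Γ.supp, Γ.proj g x = x := by
  classical
  have hx : x ∈ ⨆ g, Γ.comp g := by rw [Γ.total]; trivial
  induction hx using Submodule.iSup_induction' with
  | mem g x hx =>
    rw [Finset.sum_eq_single g, Γ.proj_of_mem hx]
    · intro h _ hne
      exact Γ.proj_of_mem_ne hx hne.symm
    · intro hg
      exact Γ.proj_eq_zero_of_notMem_supp hg x
  | zero => simp
  | add x y _ _ hx hy => simp [Finset.sum_add_distrib, hx, hy]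

theorem mem_comp_iff {g : G} {x : A} : x ∈ Γ.comp g ↔ Γ.proj g x = x :=
  ⟨Γ.proj_of_mem, fun h => h ▸ Γ.proj_mem g x⟩

theorem proj_proj_same (g : G) (x : A) : Γ.proj g (Γ.proj g x) = Γ.proj g x :=
  Γ.proj_of_mem (Γ.proj_mem g x)

theorem proj_proj_ne {g h : G} (hgh : g ≠ h) (x : A) : Γ.proj h (Γ.proj g x) = 0 :=
  Γ.proj_of_mem_ne (Γ.proj_mem g x) hgh

/-- A subspace is homogeneous if it contains the homogeneous components of its elements. -/
def IsHomog (K : Submodule F A) : Prop := ∀ g, ∀ x ∈ K, Γ.proj g x ∈ K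

/-- A family of subspaces closed under multiplication, together with a complete system of
projections onto it, is a grading. -/
def ofProj (C : G → Submodule F A) (π : G → A →ₗ[F] A) (S : Finset G)
    (hmem : ∀ g x, π g x ∈ C g) (hsame : ∀ g, ∀ x ∈ C g, π g x = x)
    (hne : ∀ g h, g ≠ h → ∀ x ∈ C g, π h x = 0) (hsum : ∀ x, ∑ g ∈ S, π g x = x)
    (hmul : ∀ g h : G, ∀ x ∈ C g, ∀ y ∈ C h, x * y ∈ C (g * h)) : AlgGrading F A G where
  comp := C
  indep g := by
    rw [Submodule.disjoint_def]
    intro x hx hx'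
    have hle : (⨆ h : G, ⨆ _ : h ≠ g, C h) ≤ LinearMap.ker (π g) :=
      iSup₂_le fun h hh y hy => hne h g hh y hy
    rw [← hsame g x hx]
    exact hle hx'
  total := by
    rw [eq_top_iff]
    intro x _
    rw [← hsum x]
    exact Submodule.sum_mem _ fun g _ => Submodule.mem_iSup_of_mem g (hmem g x)
  mul_mem := hmul

variable [FiniteDimensional F A]

theorem eq_zero_of_proj {x : A} (h : ∀ g, Γ.proj g x = 0) : x = 0 := by
  rw [← Γ.sum_proj x]
  exact Finset.sum_eq_zero fun g _ => h g

theorem mem_comp_of_proj {g : G} {x : A} (h : ∀ k, k ≠ g → Γ.proj k x = 0) :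
    x ∈ Γ.comp g := by
  rw [Γ.mem_comp_iff]
  conv_rhs => rw [← Γ.sum_proj x]
  refine (Finset.sum_eq_single g (fun k _ hk => h k hk) fun hg => ?_).symm
  exact Γ.proj_eq_zero_of_notMem_supp hg x

theorem mem_iSup_comp_iff {ι : Type*} (f : ι → G) {x : A} :
    x ∈ (⨆ i, Γ.comp (f i)) ↔ ∀ k, k ∉ Set.range f → Γ.proj k x = 0 := by
  constructor
  · intro hx k hk
    have hle : (⨆ i, Γ.comp (f i)) ≤ LinearMap.ker (Γ.proj k) :=
      iSup_le fun i y hy => Γ.proj_of_mem_ne hy fun e => hk ⟨i, e⟩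
    exact hle hx
  · intro h
    rw [← Γ.sum_proj x]
    refine Submodule.sum_mem _ fun k _ => ?_
    by_cases hk : k ∈ Set.range f
    · obtain ⟨i, rfl⟩ := hk
      exact Submodule.mem_iSup_of_mem i (Γ.proj_mem _ x)
    · rw [h k hk]
      exact Submodule.zero_mem _

theorem proj_mul_left {g : G} {a : A} (ha : a ∈ Γ.comp g) (h : G) (x : A) :
    Γ.proj (g * h) (a * x) = a * Γ.proj h x := by
  conv_lhs => rw [← Γ.sum_proj x, Finset.mul_sum, map_sum]
  rw [Finset.sum_eq_single h]
  · exact Γ.proj_of_mem (Γ.mul_mem _ _ _ ha _ (Γ.proj_mem h x))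
  · intro k _ hk
    exact Γ.proj_of_mem_ne (Γ.mul_mem _ _ _ ha _ (Γ.proj_mem k x)) (by simpa using hk)
  · intro hh
    simp [Γ.proj_eq_zero_of_notMem_supp hh]

theorem proj_mul_right {h : G} {a : A} (ha : a ∈ Γ.comp h) (g : G) (x : A) :
    Γ.proj (g * h) (x * a) = Γ.proj g x * a := by
  conv_lhs => rw [← Γ.sum_proj x, Finset.sum_mul, map_sum]
  rw [Finset.sum_eq_single g]
  · exact Γ.proj_of_mem (Γ.mul_mem _ _ _ (Γ.proj_mem g x) _ ha)
  · intro k _ hk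
    exact Γ.proj_of_mem_ne (Γ.mul_mem _ _ _ (Γ.proj_mem k x) _ ha) (by simpa using hk)
  · intro hh
    simp [Γ.proj_eq_zero_of_notMem_supp hh]

theorem one_mem : (1 : A) ∈ Γ.comp 1 := by
  have h : ∀ x : A, x * Γ.proj 1 1 = x := by
    intro x
    conv_rhs => rw [← Γ.sum_proj x]
    conv_lhs => rw [← Γ.sum_proj x, Finset.sum_mul]
    refine Finset.sum_congr rfl fun g _ => ?_
    rw [← Γ.proj_mul_left (Γ.proj_mem g x), mul_one, mul_one, Γ.proj_proj_same]
  have := h 1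
  rw [one_mul] at this
  rw [← this]
  exact Γ.proj_mem 1 1

theorem map_proj {B : Type*} [Ring B] [Algebra F B] (Γ' : AlgGrading F B G)
    (f : A →ₗ[F] B) (hf : ∀ g, ∀ x ∈ Γ.comp g, f x ∈ Γ'.comp g) (g : G) (x : A) :
    f (Γ.proj g x) = Γ'.proj g (f x) := by
  conv_rhs => rw [← Γ.sum_proj x, map_sum, map_sum]
  rw [Finset.sum_eq_single g]
  · exact (Γ'.proj_of_mem (hf g _ (Γ.proj_mem g x))).symm
  · intro k _ hk
    exact Γ'.proj_of_mem_ne (hf k _ (Γ.proj_mem k x)) hk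
  · intro hh
    simp [Γ.proj_eq_zero_of_notMem_supp hh]

theorem map_comp_eq {B : Type*} [Ring B] [Algebra F B] (Γ' : AlgGrading F B G)
    (f : A ≃ₐ[F] B) (hf : ∀ g, ∀ x ∈ Γ.comp g, f x ∈ Γ'.comp g) (g : G) :
    (Γ.comp g).map f.toLinearMap = Γ'.comp g := by
  refine le_antisymm ?_ fun y hy => ?_
  · rintro _ ⟨x, hx, rfl⟩
    exact hf g x hx
  · refine ⟨Γ.proj g (f.symm y), Γ.proj_mem _ _, ?_⟩
    rw [Γ.map_proj Γ' f.toLinearMap hf]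
    simpa using Γ'.proj_of_mem hy

end AlgGrading

end Projections

section Multiplications

variable {F : Type*} [Field F] {A : Type*} [Ring A] [Algebra F A]

/-- The multiplication algebra, spanned by the maps `x ↦ a * x * b`. -/
def multSpan (F A : Type*) [Field F] [Ring A] [Algebra F A] : Submodule F (Module.End F A) :=
  Submodule.span F (Set.range fun ab : A × A => LinearMap.mulLeftRight F ab)

theorem mulLeftRight_mem_multSpan (a b : A) :
    (LinearMap.mulLeftRight F (a, b) : Module.End F A) ∈ multSpan F A :=
  Submodule.subset_span ⟨(a, b), rfl⟩

theorem exists_mem_multSpan_sub (a b a' b' : A) :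
    ∃ T ∈ multSpan F A, ∀ x, T x = a * x * b - a' * x * b' :=
  ⟨_, Submodule.sub_mem _ (mulLeftRight_mem_multSpan a b) (mulLeftRight_mem_multSpan a' b'),
    fun x => by simp [LinearMap.mulLeftRight_apply]⟩

theorem exists_mem_multSpan_sum {ι : Type*} (S : Finset ι) (f g : ι → A) :
    ∃ T ∈ multSpan F A, ∀ x, T x = ∑ i ∈ S, f i * x * g i :=
  ⟨∑ i ∈ S, (LinearMap.mulLeftRight F (f i, g i) : Module.End F A),
    Submodule.sum_mem _ fun i _ => mulLeftRight_mem_multSpan (f i) (g i),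
    fun x => by simp [LinearMap.mulLeftRight_apply]⟩

theorem multSpan_apply_mem {K : Submodule F A} (hK : ∀ a b : A, ∀ x ∈ K, a * x * b ∈ K)
    {T : Module.End F A} (hT : T ∈ multSpan F A) {x : A} (hx : x ∈ K) : T x ∈ K := by
  induction hT using Submodule.span_induction with
  | mem T h =>
    obtain ⟨⟨a, b⟩, rfl⟩ := h
    simpa [LinearMap.mulLeftRight_apply] using hK a b x hx
  | zero => simp
  | add T T' _ _ h h' => exact K.add_mem h h'
  | smul c T _ h => exact K.smul_mem c h

namespace AlgGrading

variable {G : Type*} [CommGroup G] (Γ : AlgGrading F A G) [FiniteDimensional F A]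

/-- The degree-`h` part of a linear endomorphism of a graded algebra. -/
noncomputable def homPart (h : G) (T : Module.End F A) : Module.End F A :=
  ∑ g ∈ Γ.supp, Γ.proj (h * g) ∘ₗ T ∘ₗ Γ.proj g

theorem homPart_apply (h : G) (T : Module.End F A) (x : A) :
    Γ.homPart h T x = ∑ g ∈ Γ.supp, Γ.proj (h * g) (T (Γ.proj g x)) := by
  simp [homPart]

theorem homPart_apply_of_mem (h : G) (T : Module.End F A) {g : G} {x : A}
    (hx : x ∈ Γ.comp g) : Γ.homPart h T x = Γ.proj (h * g) (T x) := by
  rw [homPart_apply, Finset.sum_eq_single g, Γ.proj_of_mem hx]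
  · intro k _ hk
    rw [Γ.proj_of_mem_ne hx hk.symm]
    simp
  · intro hg
    rw [Γ.proj_eq_zero_of_notMem_supp hg]
    simp

theorem proj_homPart (h : G) (T : Module.End F A) (g : G) (x : A) :
    Γ.proj (h * g) (Γ.homPart h T x) = Γ.proj (h * g) (T (Γ.proj g x)) := by
  rw [homPart_apply, map_sum, Finset.sum_eq_single g, Γ.proj_proj_same]
  · intro k _ hk
    exact Γ.proj_proj_ne (by simpa using hk) _
  · intro hg
    rw [Γ.proj_eq_zero_of_notMem_supp hg]
    simp

theorem homPart_mem_multSpan (h : G) {T : Module.End F A} (hT : T ∈ multSpan F A) :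
    Γ.homPart h T ∈ multSpan F A := by
  induction hT using Submodule.span_induction with
  | mem T hT =>
    obtain ⟨⟨a, b⟩, rfl⟩ := hT
    have key : Γ.homPart h (LinearMap.mulLeftRight F (a, b)) =
        ∑ k ∈ Γ.supp, (LinearMap.mulLeftRight F (Γ.proj k a, Γ.proj (k⁻¹ * h) b) :
          Module.End F A) := by
      ext y
      rw [← Γ.sum_proj y, map_sum, map_sum]
      refine Finset.sum_congr rfl fun g _ => ?_
      rw [Γ.homPart_apply_of_mem h _ (Γ.proj_mem g y), LinearMap.sum_apply]
      simp only [LinearMap.mulLeftRight_apply]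
      conv_lhs => rw [← Γ.sum_proj a, Finset.sum_mul, Finset.sum_mul, map_sum]
      refine Finset.sum_congr rfl fun k _ => ?_
      have e : h * g = k * (g * (k⁻¹ * h)) := by
        rw [mul_comm g, ← mul_assoc, ← mul_assoc, mul_inv_cancel, one_mul]
      rw [mul_assoc, e, Γ.proj_mul_left (Γ.proj_mem k a), Γ.proj_mul_left (Γ.proj_mem g y),
        mul_assoc]
    change Γ.homPart h (LinearMap.mulLeftRight F (a, b)) ∈ _
    rw [key]
    exact Submodule.sum_mem _ fun k _ => mulLeftRight_mem_multSpan _ _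
  | zero =>
    have : Γ.homPart h 0 = 0 := by simp [homPart]
    rw [this]
    exact Submodule.zero_mem _
  | add T T' _ _ hT hT' =>
    have : Γ.homPart h (T + T') = Γ.homPart h T + Γ.homPart h T' := by
      simp [homPart, LinearMap.add_comp, LinearMap.comp_add, Finset.sum_add_distrib]
    rw [this]
    exact Submodule.add_mem _ hT hT'
  | smul c T _ hT =>
    have : Γ.homPart h (c • T) = c • Γ.homPart h T := by
      simp [homPart, LinearMap.smul_comp, LinearMap.comp_smul, Finset.smul_sum]
    rw [this]
    exact Submodule.smul_mem _ c hT

/-- Minimal length argument: modulo a homogeneous ideal `K` such that bimodule maps between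
subbimodules of `A ⧸ K` are scalar, every ideal strictly above `K` has a homogeneous element
outside `K`. -/
theorem exists_homogeneous_notMem {K D : Submodule F A} (hKh : Γ.IsHomog K) (hKD : K ≤ D)
    (hK : ∀ a b : A, ∀ x ∈ K, a * x * b ∈ K) (hD : ∀ a b : A, ∀ x ∈ D, a * x * b ∈ D)
    (hscal : ∀ y, y ∉ K → ∀ z, (∀ T ∈ multSpan F A, T y = 0 → T z ∈ K) →
      ∃ c : F, z - c • y ∈ K)
    {x : A} (hxD : x ∈ D) (hxK : x ∉ K) :
    ∃ g, ∃ y ∈ Γ.comp g, y ∈ D ∧ y ∉ K := by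
  classical
  induction hm : (Γ.supp.filter fun g => Γ.proj g x ∉ K).card using Nat.strong_induction_on
    generalizing x with
  | _ m ih =>
  obtain ⟨g₁, hg₁⟩ : ∃ g, Γ.proj g x ∉ K := by
    by_contra! hall
    exact hxK (Γ.sum_proj x ▸ Submodule.sum_mem _ fun g _ => hall g)
  have hsupp : ∀ {g : G} {z : A}, Γ.proj g z ∉ K → g ∈ Γ.supp := fun {g z} hg => by
    by_contra hn
    exact hg (by rw [Γ.proj_eq_zero_of_notMem_supp hn]; exact K.zero_mem)
  by_cases hcase : ∃ T ∈ multSpan F A, T (Γ.proj g₁ x) = 0 ∧ ∃ h, Γ.homPart h T x ∉ K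
  · obtain ⟨T, hT, hT0, h, hh⟩ := hcase
    have hTm := Γ.homPart_mem_multSpan h hT
    refine ih _ ?_ (multSpan_apply_mem hD hTm hxD) hh rfl
    rw [← hm]
    have hsub : (Γ.supp.filter fun g => Γ.proj g (Γ.homPart h T x) ∉ K) ⊆
        ((Γ.supp.filter fun g => Γ.proj g x ∉ K).erase g₁).image (h * ·) := by
      intro k hk
      obtain ⟨_, hk⟩ := Finset.mem_filter.1 hk
      have e : k = h * (h⁻¹ * k) := by simp
      rw [e, Γ.proj_homPart] at hk
      have hne : h⁻¹ * k ≠ g₁ := by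
        intro he
        rw [he, hT0, map_zero] at hk
        exact hk K.zero_mem
      have hnm : Γ.proj (h⁻¹ * k) x ∉ K := by
        intro hin
        rw [← Γ.homPart_apply_of_mem h T (Γ.proj_mem _ x)] at hk
        exact hk (multSpan_apply_mem hK hTm hin)
      exact Finset.mem_image.2 ⟨_, Finset.mem_erase.2
        ⟨hne, Finset.mem_filter.2 ⟨hsupp hnm, hnm⟩⟩, e.symm⟩
    refine lt_of_le_of_lt ((Finset.card_le_card hsub).trans Finset.card_image_le) ?_
    exact Finset.card_erase_lt_of_mem (Finset.mem_filter.2 ⟨hsupp hg₁, hg₁⟩)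
  · push Not at hcase
    have hz : ∀ g, g ≠ g₁ → Γ.proj g x ∈ K := by
      intro g hg
      obtain ⟨c, hc⟩ := hscal _ hg₁ (Γ.proj g x) fun T hT hT0 => by
        rw [← Γ.sum_proj (T (Γ.proj g x))]
        refine Submodule.sum_mem _ fun k _ => ?_
        have e : k = (k * g⁻¹) * g := by simp
        rw [e, ← Γ.proj_homPart]
        exact hKh _ _ (hcase T hT hT0 _)
      have := hKh g _ hc
      rwa [map_sub, map_smul, Γ.proj_proj_same, Γ.proj_proj_ne hg.symm, smul_zero,
        sub_zero] at this
    have hd : x - Γ.proj g₁ x ∈ K := by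
      conv => enter [2, 1]; rw [← Γ.sum_proj x, ← Finset.add_sum_erase _ _ (hsupp hg₁)]
      rw [add_sub_cancel_left]
      exact Submodule.sum_mem _ fun g hg => hz g (Finset.ne_of_mem_erase hg)
    refine ⟨g₁, _, Γ.proj_mem g₁ x, ?_, hg₁⟩
    have := D.sub_mem hxD (hKD hd)
    simpa using this

theorem isHomog_of_simple_quotient {K D : Submodule F A} (hKh : Γ.IsHomog K) (hKD : K ≤ D)
    (hK : ∀ a b : A, ∀ x ∈ K, a * x * b ∈ K) (hD : ∀ a b : A, ∀ x ∈ D, a * x * b ∈ D)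
    (hscal : ∀ y, y ∉ K → ∀ z, (∀ T ∈ multSpan F A, T y = 0 → T z ∈ K) →
      ∃ c : F, z - c • y ∈ K)
    (hsimple : ∀ y ∈ D, y ∉ K → ∀ z ∈ D, ∃ T ∈ multSpan F A, z - T y ∈ K) :
    Γ.IsHomog D := by
  by_cases hne : D ≤ K
  · rwa [le_antisymm hne hKD]
  obtain ⟨x, hxD, hxK⟩ := SetLike.not_le_iff_exists.1 hne
  obtain ⟨g, y, hyg, hyD, hyK⟩ :=
    Γ.exists_homogeneous_notMem hKh hKD hK hD hscal hxD hxK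
  intro k z hz
  obtain ⟨T, hT, hTz⟩ := hsimple y hyD hyK z hz
  have e : Γ.proj k z = Γ.proj k (z - T y) + Γ.homPart (k * g⁻¹) T y := by
    rw [Γ.homPart_apply_of_mem _ _ hyg]
    simp
  rw [e]
  exact D.add_mem (hKD (hKh k _ hTz)) (multSpan_apply_mem hD (Γ.homPart_mem_multSpan _ hT) hyD)

theorem isHomog_leftColon {K W : Submodule F A} (hK : Γ.IsHomog K) (hW : Γ.IsHomog W)
    {N : Submodule F A} (hN : ∀ x, x ∈ N ↔ ∀ w ∈ W, x * w ∈ K) : Γ.IsHomog N := by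
  intro g x hx
  rw [hN] at hx ⊢
  intro w hw
  rw [← Γ.sum_proj w, Finset.mul_sum]
  refine Submodule.sum_mem _ fun h _ => ?_
  rw [← Γ.proj_mul_right (Γ.proj_mem h w)]
  exact hK _ _ (hx _ (hW h w hw))

theorem isHomog_rightColon {K W : Submodule F A} (hK : Γ.IsHomog K) (hW : Γ.IsHomog W)
    {N : Submodule F A} (hN : ∀ x, x ∈ N ↔ ∀ w ∈ W, w * x ∈ K) : Γ.IsHomog N := by
  intro g x hx
  rw [hN] at hx ⊢
  intro w hw
  rw [← Γ.sum_proj w, Finset.sum_mul]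
  refine Submodule.sum_mem _ fun h _ => ?_
  rw [← Γ.proj_mul_left (Γ.proj_mem h w)]
  exact hK _ _ (hx _ (hW h w hw))

end AlgGrading

end Multiplications

section BlockIdeals

variable {F : Type*} [Field F] {n s : ℕ}

theorem single_one_mul_apply (i j : Fin n) (x : Matrix (Fin n) (Fin n) F) (a c : Fin n) :
    (single i j (1 : F) * x) a c = if a = i then x j c else 0 := by
  by_cases h : a = i
  · subst h; simp
  · simp [h]

theorem mul_single_one_apply (i j : Fin n) (x : Matrix (Fin n) (Fin n) F) (a c : Fin n) :
    (x * single i j (1 : F)) a c = if c = j then x a i else 0 := by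
  by_cases h : c = j
  · subst h; simp
  · simp [h]

variable (b : Fin n → Fin s)

theorem mem_UTB {x : Matrix (Fin n) (Fin n) F} :
    x ∈ UTB F b ↔ ∀ i j, b j < b i → x i j = 0 :=
  Iff.rfl

theorem single_mem_UTB {i j : Fin n} (h : b i ≤ b j) (c : F) : single i j c ∈ UTB F b := by
  rw [mem_UTB]
  intro p q hpq
  rw [single_apply, if_neg]
  rintro ⟨rfl, rfl⟩
  exact absurd h (not_le.2 hpq)

variable (F) in
/-- The matrix unit at `(i, j)` as a block triangular matrix; it is zero if `(i, j)` lies below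
the diagonal blocks. -/
def unitUTB (i j : Fin n) : UTB F b :=
  if h : b i ≤ b j then ⟨single i j 1, single_mem_UTB b h 1⟩ else 0

theorem coe_unitUTB {i j : Fin n} (h : b i ≤ b j) :
    (unitUTB F b i j : Matrix (Fin n) (Fin n) F) = single i j 1 := by
  simp [unitUTB, h]

variable (F) in
/-- Block triangular matrices supported on the positions satisfying `Q`. -/
def supportedUTB (Q : Fin n → Fin n → Prop) : Submodule F (UTB F b) where
  carrier := {x | ∀ i j, ¬ Q i j → (x : Matrix (Fin n) (Fin n) F) i j = 0}
  add_mem' {x y} hx hy i j h := by simp [hx i j h, hy i j h]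
  zero_mem' i j _ := rfl
  smul_mem' c x hx i j h := by simp [hx i j h]

theorem mem_supportedUTB {Q : Fin n → Fin n → Prop} {x : UTB F b} :
    x ∈ supportedUTB F b Q ↔ ∀ i j, ¬ Q i j → (x : Matrix (Fin n) (Fin n) F) i j = 0 :=
  Iff.rfl

theorem unitUTB_mem_supportedUTB {Q : Fin n → Fin n → Prop} {i j : Fin n} (h : Q i j) :
    unitUTB F b i j ∈ supportedUTB F b Q := by
  intro p q hpq
  unfold unitUTB
  split_ifs
  · change single i j (1 : F) p q = 0
    rw [single_apply, if_neg]
    rintro ⟨rfl, rfl⟩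
    exact hpq h
  · rfl

theorem mul_mul_mem_supportedUTB {Q : Fin n → Fin n → Prop}
    (hQ : ∀ i j i' j', Q i j → b i' ≤ b i → b j ≤ b j' → Q i' j') (a c : UTB F b) :
    ∀ x ∈ supportedUTB F b Q, a * x * c ∈ supportedUTB F b Q := by
  intro x hx i' j' hn
  rw [MulMemClass.coe_mul, mul_apply]
  refine Finset.sum_eq_zero fun j _ => ?_
  by_cases hj : b j ≤ b j'
  · rw [MulMemClass.coe_mul, mul_apply, Finset.sum_eq_zero, zero_mul]
    intro i _
    by_cases hi : b i' ≤ b i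
    · rw [hx i j fun h => hn (hQ i j i' j' h hi hj), mul_zero]
    · rw [(mem_UTB b).1 a.2 _ _ (not_le.1 hi), zero_mul]
  · rw [(mem_UTB b).1 c.2 _ _ (not_le.1 hj), mul_zero]

variable (F) in
/-- The ideal of block triangular matrices whose block rows of index at least `k` vanish. -/
def rowsBelow (k : ℕ) : Submodule F (UTB F b) := supportedUTB F b fun i _ => (b i : ℕ) < k

variable (F) in
/-- The matrices with block rows of index greater than `k` zero, and block row `k` concentrated
in the block column of `l`. -/
def rowsCorner (k : ℕ) (l : Fin n) : Submodule F (UTB F b) :=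
  supportedUTB F b fun i j => (b i : ℕ) < k ∨ ((b i : ℕ) = k ∧ b j = b l)

variable (F) in
/-- The block triangular matrices concentrated in the block column of `l`. -/
def lastColumn (l : Fin n) : Submodule F (UTB F b) := supportedUTB F b fun _ j => b j = b l

theorem rowsBelow_mul_mem (k : ℕ) (a c : UTB F b) :
    ∀ x ∈ rowsBelow F b k, a * x * c ∈ rowsBelow F b k :=
  mul_mul_mem_supportedUTB b (fun _ _ _ _ h hi _ => lt_of_le_of_lt (Fin.le_def.1 hi) h) a c

theorem rowsCorner_mul_mem (k : ℕ) {l : Fin n} (hl : ∀ j, b j ≤ b l) (a c : UTB F b) :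
    ∀ x ∈ rowsCorner F b k l, a * x * c ∈ rowsCorner F b k l := by
  refine mul_mul_mem_supportedUTB b (fun i j i' j' h hi hj => ?_) a c
  have hi := Fin.le_def.1 hi
  rcases h with h | ⟨h, h'⟩
  · left; omega
  · have : b j' = b l := le_antisymm (hl j') (h' ▸ hj)
    rcases lt_or_eq_of_le hi with h'' | h''
    · left; omega
    · right; exact ⟨by omega, this⟩

theorem coe_mul_unit_mul_apply {i i' j j' : Fin n} (hi : b i ≤ b i') (hj : b j' ≤ b j)
    (x : UTB F b) (p q : Fin n) :
    ((unitUTB F b i i' * x * unitUTB F b j' j : UTB F b) : Matrix (Fin n) (Fin n) F) p q =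
      if p = i ∧ q = j then (x : Matrix (Fin n) (Fin n) F) i' j' else 0 := by
  rw [MulMemClass.coe_mul, MulMemClass.coe_mul, coe_unitUTB b hi, coe_unitUTB b hj,
    mul_single_one_apply, single_one_mul_apply]
  by_cases hp : p = i <;> by_cases hq : q = j <;> simp [hp, hq]

variable {b} {G : Type*} [CommGroup G] (Δ : AlgGrading F (UTB F b) G)

theorem isHomog_rowsCorner {k : ℕ} {l p : Fin n} (hl : ∀ j, b j ≤ b l) (hp : (b p : ℕ) = k)
    (hk : Δ.IsHomog (rowsBelow F b k)) : Δ.IsHomog (rowsCorner F b k l) := by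
  classical
  refine Δ.isHomog_of_simple_quotient hk (fun x hx i j h => hx i j fun h' => h (Or.inl h'))
    (rowsBelow_mul_mem b k) (rowsCorner_mul_mem b k hl) ?_ ?_
  · intro y hy z hz
    simp only [rowsBelow, mem_supportedUTB, not_forall] at hy
    obtain ⟨i₀, j₀, hi₀, hy₀⟩ := hy
    have hpi : ∀ {i}, ¬ ((b i : ℕ) < k) → b p ≤ b i := fun {i} h =>
      Fin.le_def.2 (by omega)
    refine ⟨(z : Matrix (Fin n) (Fin n) F) i₀ j₀ / (y : Matrix (Fin n) (Fin n) F) i₀ j₀, ?_⟩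
    intro i j hi
    obtain ⟨T, hT, hTx⟩ := exists_mem_multSpan_sub (F := F)
      ((y : Matrix (Fin n) (Fin n) F) i₀ j₀ • unitUTB F b p i) (unitUTB F b j l)
      ((y : Matrix (Fin n) (Fin n) F) i j • unitUTB F b p i₀) (unitUTB F b j₀ l)
    have hent : ∀ (x : UTB F b) (u v : Fin n),
        (T x : Matrix (Fin n) (Fin n) F) u v = if u = p ∧ v = l then
          (y : Matrix (Fin n) (Fin n) F) i₀ j₀ * (x : Matrix (Fin n) (Fin n) F) i j -
          (y : Matrix (Fin n) (Fin n) F) i j * (x : Matrix (Fin n) (Fin n) F) i₀ j₀ else 0 := by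
      intro x u v
      rw [hTx, smul_mul_assoc, smul_mul_assoc, smul_mul_assoc, smul_mul_assoc,
        AddSubgroupClass.coe_sub, SetLike.val_smul, SetLike.val_smul, Matrix.sub_apply,
        Matrix.smul_apply, Matrix.smul_apply, coe_mul_unit_mul_apply b (hpi hi) (hl _),
        coe_mul_unit_mul_apply b (hpi hi₀) (hl _)]
      split_ifs <;> simp
    have hT0 : T y = 0 := by
      ext u v
      rw [hent]
      split_ifs
      · rw [mul_comm, sub_self]; rfl
      · rfl
    have := hz T hT hT0 p l (by omega)
    rw [hent, if_pos ⟨rfl, rfl⟩] at this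
    rw [AddSubgroupClass.coe_sub, SetLike.val_smul, Matrix.sub_apply, Matrix.smul_apply,
      smul_eq_mul]
    field_simp
    linear_combination this
  · intro y hy hyK z hz
    simp only [rowsBelow, mem_supportedUTB, not_forall] at hyK
    obtain ⟨i, j, hi, hij⟩ := hyK
    obtain ⟨hik, hjl⟩ : (b i : ℕ) = k ∧ b j = b l := by
      by_contra hcon
      exact hij (hy i j (by tauto))
    obtain ⟨T, hT, hTx⟩ := exists_mem_multSpan_sum (F := F)
      (Finset.univ.filter fun q : Fin n × Fin n => (b q.1 : ℕ) = k ∧ b q.2 = b l)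
      (fun q => ((z : Matrix (Fin n) (Fin n) F) q.1 q.2 /
        (y : Matrix (Fin n) (Fin n) F) i j) • unitUTB F b q.1 i)
      (fun q => unitUTB F b j q.2)
    refine ⟨T, hT, fun u v hu => ?_⟩
    have hsum : (T y : Matrix (Fin n) (Fin n) F) u v =
        if (b u : ℕ) = k ∧ b v = b l then (z : Matrix (Fin n) (Fin n) F) u v else 0 := by
      rw [hTx, AddSubmonoidClass.coe_finsetSum, Matrix.sum_apply]
      have hterm : ∀ q ∈ Finset.univ.filter
            fun q : Fin n × Fin n => (b q.1 : ℕ) = k ∧ b q.2 = b l,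
          ((((z : Matrix (Fin n) (Fin n) F) q.1 q.2 / (y : Matrix (Fin n) (Fin n) F) i j) •
            unitUTB F b q.1 i * y * unitUTB F b j q.2 : UTB F b) :
              Matrix (Fin n) (Fin n) F) u v =
          if q = (u, v) then (z : Matrix (Fin n) (Fin n) F) u v else 0 := by
        intro q hq
        obtain ⟨hq₁, hq₂⟩ := (Finset.mem_filter.1 hq).2
        rw [smul_mul_assoc, smul_mul_assoc, SetLike.val_smul, Matrix.smul_apply,
          coe_mul_unit_mul_apply b (Fin.le_def.2 (by omega)) (by rw [hq₂, hjl])]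
        by_cases h : q = (u, v)
        · subst h
          simp [hij]
        · rw [if_neg h, if_neg, smul_zero]
          rintro ⟨rfl, rfl⟩
          exact h rfl
      rw [Finset.sum_congr rfl hterm, Finset.sum_ite_eq']
      simp
    rw [AddSubgroupClass.coe_sub, Matrix.sub_apply, hsum]
    split_ifs with h
    · exact sub_self _
    · rw [hz u v (by tauto), sub_zero]

theorem isHomog_lastColumn (hs : Function.Surjective b) {l : Fin n} (hl : ∀ j, b j ≤ b l) :
    Δ.IsHomog (lastColumn F b l) := by
  have hbot : Δ.IsHomog ⊥ := fun g x hx => by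
    rw [Submodule.mem_bot] at hx ⊢
    rw [hx, map_zero]
  have hzero : Δ.IsHomog (rowsBelow F b 0) := by
    have : rowsBelow F b 0 = ⊥ := by
      rw [eq_bot_iff]
      intro x hx
      ext i j
      exact hx i j (by simp)
    rwa [this]
  have hspos : 0 < s := lt_of_le_of_lt (Nat.zero_le _) (b l).2
  obtain ⟨z, hz⟩ := hs ⟨0, hspos⟩
  have hz0 : (b z : ℕ) = 0 := by rw [hz]
  have hzle : ∀ j, b z ≤ b j := fun j => Fin.le_def.2 (by omega)
  have hC := isHomog_rowsCorner Δ hl hz0 hzero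
  have hR : Δ.IsHomog (supportedUTB F b fun i _ => b i ≠ b l) := by
    refine Δ.isHomog_rightColon hbot hC fun x => ⟨fun hx w hw => ?_, fun hx i j h => ?_⟩
    · rw [Submodule.mem_bot]
      ext i j
      rw [MulMemClass.coe_mul, mul_apply]
      refine Finset.sum_eq_zero fun t _ => ?_
      by_cases ht : b t = b l
      · rw [hx t j (by simpa using ht), mul_zero]
      · rw [hw i t (by simp [ht]), zero_mul]
    · have := hx (unitUTB F b z i) (unitUTB_mem_supportedUTB b (Or.inr ⟨hz0, by simpa using h⟩))
      rw [Submodule.mem_bot] at this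
      have := congrFun (congrFun (congrArg Subtype.val this) z) j
      rw [MulMemClass.coe_mul, coe_unitUTB b (hzle i), single_one_mul_apply, if_pos rfl] at this
      exact this
  refine Δ.isHomog_leftColon hbot hR fun x => ⟨fun hx w hw => ?_, fun hx i j h => ?_⟩
  · rw [Submodule.mem_bot]
    ext i j
    rw [MulMemClass.coe_mul, mul_apply]
    refine Finset.sum_eq_zero fun t _ => ?_
    by_cases ht : b t = b l
    · rw [hw t j (by simpa using ht), mul_zero]
    · rw [hx i t ht, zero_mul]
  · have := hx (unitUTB F b j j) (unitUTB_mem_supportedUTB b h)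
    rw [Submodule.mem_bot] at this
    have := congrFun (congrFun (congrArg Subtype.val this) i) j
    rw [MulMemClass.coe_mul, coe_unitUTB b le_rfl, mul_single_one_apply, if_pos rfl] at this
    exact this

theorem isHomog_rowsBelow (hs : Function.Surjective b) {l : Fin n} (hl : ∀ j, b j ≤ b l)
    {k : ℕ} (hk : k ≤ s) : Δ.IsHomog (rowsBelow F b k) := by
  induction k with
  | zero =>
    have : rowsBelow F b 0 = ⊥ := by
      rw [eq_bot_iff]
      intro x hx
      ext i j
      exact hx i j (by simp)
    rw [this]
    intro g x hx
    rw [Submodule.mem_bot] at hx ⊢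
    rw [hx, map_zero]
  | succ k ih =>
    obtain ⟨p, hp⟩ := hs ⟨k, hk⟩
    have hD := isHomog_rowsCorner (k := k) (p := p) Δ hl (by rw [hp]) (ih (by omega))
    refine Δ.isHomog_leftColon hD (isHomog_lastColumn Δ hs hl)
      fun x => ⟨fun hx w hw => ?_, fun hx i j h => ?_⟩
    · intro i j hij
      rw [MulMemClass.coe_mul, mul_apply]
      refine Finset.sum_eq_zero fun t _ => ?_
      by_cases hi : (b i : ℕ) < k + 1
      · rw [hw t j fun hj => hij (by by_cases h : (b i : ℕ) < k
                                     · exact Or.inl h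
                                     · exact Or.inr ⟨by omega, hj⟩), mul_zero]
      · rw [hx i t hi, zero_mul]
    · have := hx (unitUTB F b j l) (unitUTB_mem_supportedUTB b rfl) i l (by omega)
      rw [MulMemClass.coe_mul, coe_unitUTB b (hl j), mul_single_one_apply, if_pos rfl] at this
      exact this

end BlockIdeals

section Extension

namespace AlgGrading

variable {F : Type*} [Field F] {A : Type*} [Ring A] [Algebra F A] {G : Type*} [CommGroup G]
  (Γ : AlgGrading F A G) [FiniteDimensional F A]

theorem homPart_apply_mem {W : Submodule F A} (hW : Γ.IsHomog W) (g : G) {T : Module.End F A}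
    (hT : ∀ y ∈ W, T y ∈ W) {y : A} (hy : y ∈ W) : Γ.homPart g T y ∈ W := by
  rw [homPart_apply]
  exact Submodule.sum_mem _ fun h _ => hW _ _ (hT _ (hW _ _ hy))

theorem homPart_mul_right {W : Submodule F A} (hW : Γ.IsHomog W) (g : G) {T : Module.End F A}
    (hT : ∀ y ∈ W, ∀ u, T (y * u) = T y * u) {y : A} (hy : y ∈ W) (u : A) :
    Γ.homPart g T (y * u) = Γ.homPart g T y * u := by
  rw [← Γ.sum_proj y, ← Γ.sum_proj u, Finset.sum_mul_sum, map_sum, map_sum, Finset.sum_mul_sum]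
  refine Finset.sum_congr rfl fun h _ => ?_
  rw [map_sum]
  refine Finset.sum_congr rfl fun k _ => ?_
  rw [Γ.homPart_apply_of_mem g T (Γ.proj_mem h y), Γ.homPart_apply_of_mem g T
    (Γ.mul_mem h k _ (Γ.proj_mem h y) _ (Γ.proj_mem k u)), hT _ (hW h y hy), ← mul_assoc,
    Γ.proj_mul_right (Γ.proj_mem k u)]

end AlgGrading

variable {F : Type*} [Field F] {n s : ℕ} {b : Fin n → Fin s} {l : Fin n}

/-- Left multiplication by a matrix, followed by projection to the block column of `l`, as an
endomorphism of the algebra of block triangular matrices. -/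
def columnMul (hl : ∀ j, b j ≤ b l) :
    Matrix (Fin n) (Fin n) F →ₗ[F] UTB F b →ₗ[F] UTB F b :=
  LinearMap.mk₂ F (fun x y => ⟨Matrix.of fun i j =>
      if b j = b l then (x * (y : Matrix (Fin n) (Fin n) F)) i j else 0, by
        rw [mem_UTB]
        intro i j hij
        rw [of_apply, if_neg]
        exact ne_of_lt (lt_of_lt_of_le hij (hl i))⟩)
    (fun x x' y => by ext i j; simp [add_mul]; split_ifs <;> simp)
    (fun c x y => by ext i j; simp)
    (fun x y y' => by ext i j; simp [mul_add]; split_ifs <;> simp)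
    (fun c x y => by ext i j; simp)

theorem mul_unitUTB (hl : ∀ j, b j ≤ b l) (y : UTB F b) (j : Fin n) :
    y * unitUTB F b j l = ∑ t, (y : Matrix (Fin n) (Fin n) F) t j • unitUTB F b t l := by
  ext u v
  rw [AddSubmonoidClass.coe_finsetSum, Matrix.sum_apply, MulMemClass.coe_mul,
    coe_unitUTB b (hl j), mul_single_one_apply]
  have : ∀ t, (((y : Matrix (Fin n) (Fin n) F) t j • unitUTB F b t l : UTB F b) :
      Matrix (Fin n) (Fin n) F) u v =
      if t = u then if v = l then (y : Matrix (Fin n) (Fin n) F) u j else 0 else 0 := by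
    intro t
    rw [SetLike.val_smul, coe_unitUTB b (hl t), Matrix.smul_apply, single_apply]
    by_cases ht : t = u <;> by_cases hv : v = l
    · subst ht hv; simp
    · simp [hv, Ne.symm hv]
    all_goals simp [ht]
  rw [Finset.sum_congr rfl fun t _ => this t]
  simp

theorem lastColumn_mul_mem (hl : ∀ j, b j ≤ b l) {y : UTB F b} (hy : y ∈ lastColumn F b l)
    (u : UTB F b) : y * u ∈ lastColumn F b l := by
  have := mul_mul_mem_supportedUTB b (Q := fun _ j => b j = b l)
    (fun _ _ _ j' h _ hj => le_antisymm (hl j') (h ▸ hj)) 1 u y hy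
  rwa [one_mul] at this

variable (hl : ∀ j, b j ≤ b l)

theorem columnMul_mem_lastColumn (x : Matrix (Fin n) (Fin n) F) (y : UTB F b) :
    columnMul hl x y ∈ lastColumn F b l :=
  fun _ _ h => if_neg h

theorem coe_columnMul (x : Matrix (Fin n) (Fin n) F) {y : UTB F b} (hy : y ∈ lastColumn F b l) :
    (columnMul hl x y : Matrix (Fin n) (Fin n) F) = x * y := by
  ext i j
  by_cases h : b j = b l
  · exact if_pos h
  · refine (if_neg h).trans ?_
    rw [mul_apply, Finset.sum_eq_zero]
    intro t _
    rw [hy t j h, mul_zero]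

theorem columnMul_coe (x : UTB F b) {y : UTB F b} (hy : y ∈ lastColumn F b l) :
    columnMul hl (x : Matrix (Fin n) (Fin n) F) y = x * y :=
  Subtype.ext (coe_columnMul hl _ hy)

theorem columnMul_mul_right (x : Matrix (Fin n) (Fin n) F) :
    ∀ y ∈ lastColumn F b l, ∀ u, columnMul hl x (y * u) = columnMul hl x y * u := by
  intro y hy u
  apply Subtype.ext
  rw [coe_columnMul hl x (lastColumn_mul_mem hl hy u), MulMemClass.coe_mul, MulMemClass.coe_mul,
    coe_columnMul hl x hy, mul_assoc]

theorem unitUTB_mem_lastColumn (j : Fin n) : unitUTB F b j l ∈ lastColumn F b l :=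
  unitUTB_mem_supportedUTB b rfl

theorem columnMul_unitUTB_apply (x : Matrix (Fin n) (Fin n) F) (i j : Fin n) :
    (columnMul hl x (unitUTB F b j l) : Matrix (Fin n) (Fin n) F) i l = x i j := by
  rw [coe_columnMul hl x (unitUTB_mem_lastColumn j), coe_unitUTB b (hl j),
    mul_single_one_apply, if_pos rfl]

theorem columnMul_mul_apply (x x' : Matrix (Fin n) (Fin n) F) {y : UTB F b}
    (hy : y ∈ lastColumn F b l) :
    columnMul hl (x * x') y = columnMul hl x (columnMul hl x' y) := by
  apply Subtype.ext
  rw [coe_columnMul hl _ hy, coe_columnMul hl _ (columnMul_mem_lastColumn hl _ _),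
    coe_columnMul hl _ hy, mul_assoc]

variable {G : Type*} [CommGroup G] (Δ : AlgGrading F (UTB F b) G)

theorem columnMul_ext (hL : Δ.IsHomog (lastColumn F b l)) {x x' : Matrix (Fin n) (Fin n) F}
    (h : ∀ g, ∀ y ∈ lastColumn F b l, y ∈ Δ.comp g → columnMul hl x y = columnMul hl x' y) :
    x = x' := by
  ext i j
  rw [← columnMul_unitUTB_apply hl x, ← columnMul_unitUTB_apply hl x',
    ← Δ.sum_proj (unitUTB F b j l), map_sum, map_sum]
  exact congrArg (fun y : UTB F b => (y : Matrix (Fin n) (Fin n) F) i l)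
    (Finset.sum_congr rfl fun g _ =>
      h g _ (hL g _ (unitUTB_mem_lastColumn j)) (Δ.proj_mem g _))

/-- The degree-`g` part of a matrix acting on the last block column of a graded algebra of block
triangular matrices. -/
noncomputable def matrixPart (g : G) :
    Matrix (Fin n) (Fin n) F →ₗ[F] Matrix (Fin n) (Fin n) F where
  toFun x := Matrix.of fun i j =>
    (Δ.homPart g (columnMul hl x) (unitUTB F b j l) : Matrix (Fin n) (Fin n) F) i l
  map_add' x x' := by
    ext i j
    simp [AlgGrading.homPart_apply, Matrix.sum_apply, Finset.sum_add_distrib]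
  map_smul' c x := by
    ext i j
    simp [AlgGrading.homPart_apply, Matrix.sum_apply, Finset.mul_sum]

theorem columnMul_matrixPart (hL : Δ.IsHomog (lastColumn F b l)) (g : G)
    (x : Matrix (Fin n) (Fin n) F) {y : UTB F b} (hy : y ∈ lastColumn F b l) :
    columnMul hl (matrixPart hl Δ g x) y = Δ.homPart g (columnMul hl x) y := by
  have hmem : Δ.homPart g (columnMul hl x) y ∈ lastColumn F b l :=
    Δ.homPart_apply_mem hL g (fun y _ => columnMul_mem_lastColumn hl x y) hy
  ext i j
  by_cases hj : b j = b l
  · have hmul := mul_unitUTB hl y j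
    have h₁ := Δ.homPart_mul_right hL g (columnMul_mul_right hl x) hy (unitUTB F b j l)
    have h₂ := congrFun (congrFun (congrArg Subtype.val h₁) i) l
    rw [MulMemClass.coe_mul, coe_unitUTB b (hl j), mul_single_one_apply, if_pos rfl] at h₂
    rw [← h₂, hmul, map_sum, coe_columnMul hl _ hy, AddSubmonoidClass.coe_finsetSum,
      Matrix.sum_apply, mul_apply]
    refine Finset.sum_congr rfl fun t _ => ?_
    rw [map_smul, SetLike.val_smul, Matrix.smul_apply, smul_eq_mul, mul_comm]
    rfl
  · rw [hmem i j hj]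
    exact if_neg hj

open Pointwise in
/-- The grading of the full matrix algebra extending a grading of the algebra of block triangular
matrices for which the last block column is homogeneous. -/
noncomputable def extendGrading (hL : Δ.IsHomog (lastColumn F b l)) :
    AlgGrading F (Matrix (Fin n) (Fin n) F) G := by
  classical
  exact AlgGrading.ofProj
    (fun g =>
      { carrier := {x | ∀ h, ∀ y ∈ lastColumn F b l, y ∈ Δ.comp h →
          columnMul hl x y ∈ Δ.comp (g * h)}
        add_mem' := fun {x x'} hx hx' h y hy hyh => by
          rw [map_add]
          exact Submodule.add_mem _ (hx h y hy hyh) (hx' h y hy hyh)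
        zero_mem' := fun h y _ _ => by
          rw [map_zero]
          exact Submodule.zero_mem _
        smul_mem' := fun c x hx h y hy hyh => by
          rw [map_smul]
          exact Submodule.smul_mem _ c (hx h y hy hyh) })
    (matrixPart hl Δ) (Δ.supp * Δ.supp⁻¹)
    (by
      intro g x h y hy hyh
      rw [columnMul_matrixPart hl Δ hL g x hy, Δ.homPart_apply_of_mem g _ hyh]
      exact Δ.proj_mem _ _)
    (by
      intro g x hx
      refine columnMul_ext hl Δ hL fun h y hy hyh => ?_
      rw [columnMul_matrixPart hl Δ hL g x hy, Δ.homPart_apply_of_mem g _ hyh]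
      exact Δ.proj_of_mem (hx h y hy hyh))
    (by
      intro g g' hg x hx
      refine columnMul_ext hl Δ hL fun h y hy hyh => ?_
      rw [columnMul_matrixPart hl Δ hL g' x hy, Δ.homPart_apply_of_mem g' _ hyh, map_zero]
      exact Δ.proj_of_mem_ne (hx h y hy hyh) (by simpa using hg))
    (by
      intro x
      refine columnMul_ext hl Δ hL fun h y hy hyh => ?_
      rw [map_sum, LinearMap.sum_apply]
      rw [Finset.sum_congr rfl fun g _ => by
        rw [columnMul_matrixPart hl Δ hL g x hy, Δ.homPart_apply_of_mem g _ hyh]]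
      by_cases hh : h ∈ Δ.supp
      · rw [← Finset.sum_image (s := Δ.supp * Δ.supp⁻¹) (g := fun g => g * h)
          (f := fun k => Δ.proj k (columnMul hl x y)) (fun g _ g' _ e => by simpa using e)]
        conv_rhs => rw [← Δ.sum_proj (columnMul hl x y)]
        refine (Finset.sum_subset (fun k hk => ?_) fun k _ hk => ?_).symm
        · exact Finset.mem_image.2 ⟨k * h⁻¹, Finset.mul_mem_mul hk (Finset.inv_mem_inv hh),
            by simp⟩
        · exact Δ.proj_eq_zero_of_notMem_supp hk _
      · have : y = 0 := by
          rw [← Δ.proj_of_mem hyh, Δ.proj_eq_zero_of_notMem_supp hh]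
        simp [this])
    (by
      intro g g' x hx x' hx' h y hy hyh
      rw [columnMul_mul_apply hl x x' hy, mul_assoc]
      exact hx _ _ (columnMul_mem_lastColumn hl _ _) (hx' h y hy hyh))

theorem mem_extendGrading {hL : Δ.IsHomog (lastColumn F b l)} {g : G}
    {x : Matrix (Fin n) (Fin n) F} :
    x ∈ (extendGrading hl Δ hL).comp g ↔
      ∀ h, ∀ y ∈ lastColumn F b l, y ∈ Δ.comp h → columnMul hl x y ∈ Δ.comp (g * h) :=
  Iff.rfl

theorem coe_mem_extendGrading (hL : Δ.IsHomog (lastColumn F b l)) {g : G} {x : UTB F b} :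
    (x : Matrix (Fin n) (Fin n) F) ∈ (extendGrading hl Δ hL).comp g ↔ x ∈ Δ.comp g := by
  have hle : ∀ g, ∀ x ∈ Δ.comp g,
      (x : Matrix (Fin n) (Fin n) F) ∈ (extendGrading hl Δ hL).comp g := by
    intro g x hx
    rw [mem_extendGrading]
    intro h y hy hyh
    rw [columnMul_coe hl x hy]
    exact Δ.mul_mem _ _ _ hx _ hyh
  refine ⟨fun hx => ?_, hle g x⟩
  have := Δ.map_proj (extendGrading hl Δ hL) (UTB F b).val.toLinearMap hle g x
  rw [Δ.mem_comp_iff]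
  apply Subtype.ext
  exact this.trans ((extendGrading hl Δ hL).proj_of_mem hx)

variable (F b) in
/-- The right ideal of matrices whose block rows of index at least `k` vanish. -/
def rowIdeal (k : ℕ) : Submodule F (Matrix (Fin n) (Fin n) F) where
  carrier := {x | ∀ i j, k ≤ (b i : ℕ) → x i j = 0}
  add_mem' {x y} hx hy i j h := by simp [hx i j h, hy i j h]
  zero_mem' i j _ := rfl
  smul_mem' c x hx i j h := by simp [hx i j h]

theorem rowIdeal_mul_mem {k : ℕ} {x : Matrix (Fin n) (Fin n) F} (hx : x ∈ rowIdeal F b k)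
    (y : Matrix (Fin n) (Fin n) F) : x * y ∈ rowIdeal F b k := by
  intro i j h
  rw [mul_apply, Finset.sum_eq_zero]
  intro t _
  rw [hx i t h, zero_mul]

theorem mem_rowIdeal_iff_columnMul {k : ℕ} {x : Matrix (Fin n) (Fin n) F} :
    x ∈ rowIdeal F b k ↔ ∀ y ∈ lastColumn F b l, columnMul hl x y ∈ rowsBelow F b k := by
  refine ⟨fun hx y hy i j h => ?_, fun hx i j h => ?_⟩
  · rw [coe_columnMul hl x hy]
    exact rowIdeal_mul_mem hx _ i j (not_lt.1 h)
  · rw [← columnMul_unitUTB_apply hl x]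
    exact hx _ (unitUTB_mem_lastColumn j) i l (not_lt.2 h)

theorem isHomog_rowIdeal (hL : Δ.IsHomog (lastColumn F b l)) {k : ℕ}
    (hk : Δ.IsHomog (rowsBelow F b k)) :
    (extendGrading hl Δ hL).IsHomog (rowIdeal F b k) := by
  intro g x hx
  rw [mem_rowIdeal_iff_columnMul hl] at hx ⊢
  intro y hy
  rw [← Δ.sum_proj y, map_sum]
  refine Submodule.sum_mem _ fun h _ => ?_
  have hyh := hL h y hy
  let E := extendGrading hl Δ hL
  let f : Matrix (Fin n) (Fin n) F →ₗ[F] UTB F b := (columnMul hl).flip (Δ.proj h y)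
  have key : f (E.proj g x) = Δ.proj (g * h) (f x) := by
    conv_rhs => rw [← E.sum_proj x, map_sum, map_sum]
    rw [Finset.sum_eq_single g]
    · exact (Δ.proj_of_mem (E.proj_mem g x h _ hyh (Δ.proj_mem h y))).symm
    · intro k _ hk
      exact Δ.proj_of_mem_ne (E.proj_mem k x h _ hyh (Δ.proj_mem h y)) (by simpa using hk)
    · intro hh
      simp [E.proj_eq_zero_of_notMem_supp hh]
  change f (E.proj g x) ∈ _
  rw [key]
  exact hk _ _ (hx _ hyh)

end Extension

section Idempotents

namespace AlgGrading

variable {F : Type*} [Field F] {A : Type*} [Ring A] [Algebra F A] {G : Type*} [CommGroup G]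
  {Γ : AlgGrading F A G}

theorem IsHomog.sup {K N : Submodule F A} (hK : Γ.IsHomog K) (hN : Γ.IsHomog N) :
    Γ.IsHomog (K ⊔ N) := by
  intro g x hx
  obtain ⟨y, hy, z, hz, rfl⟩ := Submodule.mem_sup.1 hx
  rw [map_add]
  exact Submodule.add_mem_sup (hK g y hy) (hN g z hz)

theorem isHomog_bot : Γ.IsHomog ⊥ := fun g x hx => by
  rw [Submodule.mem_bot] at hx ⊢
  rw [hx, map_zero]

theorem isHomog_top : Γ.IsHomog ⊤ := fun _ _ _ => trivial

theorem sup_mul_mem {K N : Submodule F A} (hK : ∀ x ∈ K, ∀ r, x * r ∈ K)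
    (hN : ∀ x ∈ N, ∀ r, x * r ∈ N) : ∀ x ∈ K ⊔ N, ∀ r, x * r ∈ K ⊔ N := by
  intro x hx r
  obtain ⟨y, hy, z, hz, rfl⟩ := Submodule.mem_sup.1 hx
  rw [add_mul]
  exact Submodule.add_mem_sup (hK y hy r) (hN z hz r)

variable (Γ) [FiniteDimensional F A]

theorem exists_minimal_homogeneous_rightIdeal [Nontrivial A] :
    ∃ S : Submodule F A, Γ.IsHomog S ∧ (∀ x ∈ S, ∀ r, x * r ∈ S) ∧ S ≠ ⊥ ∧
      ∀ W ≤ S, Γ.IsHomog W → (∀ x ∈ W, ∀ r, x * r ∈ W) → W ≠ S → W = ⊥ := by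
  obtain ⟨S, ⟨hS, hSr, hS0⟩, hmin⟩ := (wellFounded_lt (α := Submodule F A)).has_min
    {S | Γ.IsHomog S ∧ (∀ x ∈ S, ∀ r, x * r ∈ S) ∧ S ≠ ⊥}
    ⟨⊤, isHomog_top, fun _ _ _ => trivial, top_ne_bot⟩
  refine ⟨S, hS, hSr, hS0, fun W hWS hW hWr hne => ?_⟩
  by_contra hW0
  exact hmin W ⟨hW, hWr, hW0⟩ (lt_of_le_of_ne hWS hne)

/-- In a graded algebra in which every nonzero right ideal generates the whole algebra as a
two-sided ideal, homogeneous right ideals have homogeneous complements. -/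
theorem exists_homogeneous_complement
    (hA : ∀ S M : Submodule F A, S ≠ ⊥ → (∀ x ∈ S, ∀ r, x * r ∈ S) →
      (∀ a, ∀ x ∈ S, a * x ∈ M) → M = ⊤)
    {N : Submodule F A} (hN : Γ.IsHomog N) (hNr : ∀ x ∈ N, ∀ r, x * r ∈ N) :
    ∃ K : Submodule F A, Γ.IsHomog K ∧ (∀ x ∈ K, ∀ r, x * r ∈ K) ∧ N ⊓ K = ⊥ ∧ N ⊔ K = ⊤ := by
  cases subsingleton_or_nontrivial A with
  | inl _ => exact ⟨⊥, isHomog_bot, fun x _ r => by simp [Subsingleton.elim x 0],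
      Subsingleton.elim _ _, Subsingleton.elim _ _⟩
  | inr _ =>
  obtain ⟨K, ⟨hK, hKr, hNK⟩, hmax⟩ := (wellFounded_gt (α := Submodule F A)).has_min
    {K | Γ.IsHomog K ∧ (∀ x ∈ K, ∀ r, x * r ∈ K) ∧ N ⊓ K = ⊥}
    ⟨⊥, isHomog_bot, fun x hx r => by
      rw [Submodule.mem_bot] at hx ⊢
      rw [hx, zero_mul], by simp⟩
  refine ⟨K, hK, hKr, hNK, ?_⟩
  by_contra hne
  obtain ⟨S, hS, hSr, hS0, hmin⟩ := Γ.exists_minimal_homogeneous_rightIdeal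
  have hM := hN.sup hK
  have hMr := sup_mul_mem hNr hKr
  obtain ⟨a, y, hy, hay⟩ : ∃ a, ∃ y ∈ S, a * y ∉ N ⊔ K := by
    by_contra! hcon
    exact hne (hA S _ hS0 hSr hcon)
  obtain ⟨g, c, hc, hcy⟩ : ∃ g, ∃ c ∈ Γ.comp g, c * y ∉ N ⊔ K := by
    by_contra! hcon
    apply hay
    rw [← Γ.sum_proj a, Finset.sum_mul]
    exact Submodule.sum_mem _ fun g _ => hcon g _ (Γ.proj_mem g a)
  have hW : S ⊓ (N ⊔ K).comap (LinearMap.mulLeft F c) = ⊥ := by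
    refine hmin _ inf_le_left ?_ ?_ ?_
    · rintro h x ⟨hxS, hxM⟩
      refine ⟨hS h x hxS, ?_⟩
      change c * Γ.proj h x ∈ N ⊔ K
      rw [← Γ.proj_mul_left hc]
      exact hM _ _ hxM
    · rintro x ⟨hxS, hxM⟩ r
      refine ⟨hSr x hxS r, ?_⟩
      change c * (x * r) ∈ N ⊔ K
      rw [← mul_assoc]
      exact hMr _ hxM r
    · intro he
      exact hcy ((he.symm ▸ hy : y ∈ S ⊓ (N ⊔ K).comap (LinearMap.mulLeft F c)).2)
  have hcS : Γ.IsHomog (S.map (LinearMap.mulLeft F c)) := by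
    rintro k _ ⟨x, hx, rfl⟩
    refine ⟨Γ.proj (g⁻¹ * k) x, hS _ x hx, ?_⟩
    have := Γ.proj_mul_left hc (g⁻¹ * k) x
    rw [mul_inv_cancel_left] at this
    exact this.symm
  refine hmax (K ⊔ S.map (LinearMap.mulLeft F c)) ⟨hK.sup hcS, sup_mul_mem hKr ?_, ?_⟩ ?_
  · rintro _ ⟨x, hx, rfl⟩ r
    exact ⟨x * r, hSr x hx r, (mul_assoc c x r).symm⟩
  · rw [eq_bot_iff]
    rintro u ⟨huN, huK⟩
    obtain ⟨k, hk, _, ⟨x, hx, rfl⟩, rfl⟩ := Submodule.mem_sup.1 huK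
    have hx0 : x ∈ S ⊓ (N ⊔ K).comap (LinearMap.mulLeft F c) := by
      refine ⟨hx, ?_⟩
      have := Submodule.sub_mem _ (Submodule.mem_sup_left huN : _ ∈ N ⊔ K)
        (Submodule.mem_sup_right hk)
      rwa [add_sub_cancel_left] at this
    rw [hW, Submodule.mem_bot] at hx0
    subst hx0
    rw [map_zero, add_zero] at huN ⊢
    rw [← hNK]
    exact ⟨huN, hk⟩
  · refine lt_of_le_of_ne le_sup_left fun he => hcy (Submodule.mem_sup_right ?_)
    rw [he]
    exact Submodule.mem_sup_right ⟨y, hy, rfl⟩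

theorem exists_leftIdentity_mem_comp_one {N K : Submodule F A} (hN : Γ.IsHomog N)
    (hNr : ∀ x ∈ N, ∀ r, x * r ∈ N) (hK : Γ.IsHomog K) (hKr : ∀ x ∈ K, ∀ r, x * r ∈ K)
    (hNK : N ⊓ K = ⊥) (hNK' : N ⊔ K = ⊤) :
    ∃ p ∈ Γ.comp 1, p ∈ N ∧ ∀ x ∈ N, p * x = x := by
  obtain ⟨p, hp, q, hq, hpq⟩ := Submodule.mem_sup.1 (hNK' ▸ trivial : (1 : A) ∈ N ⊔ K)
  refine ⟨Γ.proj 1 p, Γ.proj_mem 1 p, hN 1 p hp, fun x hx => ?_⟩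
  have h1 : Γ.proj 1 p + Γ.proj 1 q = 1 := by
    rw [← map_add, hpq, Γ.proj_of_mem Γ.one_mem]
  have hxs : Γ.proj 1 p * x + Γ.proj 1 q * x = x := by rw [← add_mul, h1, one_mul]
  have hqx : Γ.proj 1 q * x ∈ N ⊓ K := by
    refine ⟨?_, hKr _ (hK 1 q hq) x⟩
    rw [← add_sub_cancel_left (Γ.proj 1 p * x) (Γ.proj 1 q * x), hxs]
    exact Submodule.sub_mem _ hx (hNr _ (hN 1 p hp) x)
  rw [hNK, Submodule.mem_bot] at hqx
  rwa [hqx, add_zero] at hxs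

theorem exists_idempotents {N : ℕ → Submodule F A} (hmono : Monotone N) (h0 : N 0 = ⊥)
    (hNr : ∀ k, ∀ x ∈ N k, ∀ r, x * r ∈ N k)
    (hN : ∀ k, ∃ p ∈ Γ.comp 1, p ∈ N k ∧ ∀ x ∈ N k, p * x = x) :
    ∃ q : ℕ → A, (∀ k, q k ∈ Γ.comp 1) ∧ (∀ k, q k ∈ N k) ∧ (∀ k, ∀ x ∈ N k, q k * x = x) ∧
      ∀ i j, i ≤ j → q i * q j = q i := by
  choose p hp1 hpN hpx using hN
  let q : ℕ → A := fun k => Nat.rec 0 (fun k r => r + (1 - r) * p (k + 1) * (1 - r)) k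
  have hq : ∀ k, q (k + 1) = q k + (1 - q k) * p (k + 1) * (1 - q k) := fun k => rfl
  have hq1 : ∀ k, q k ∈ Γ.comp 1 := by
    intro k
    induction k with
    | zero => exact Submodule.zero_mem _
    | succ k ih =>
      rw [hq]
      have h1 := Submodule.sub_mem _ Γ.one_mem ih
      have := Γ.mul_mem _ _ _ (Γ.mul_mem _ _ _ h1 _ (hp1 (k + 1))) _ h1
      rw [mul_one, mul_one] at this
      exact Submodule.add_mem _ ih this
  have hqN : ∀ k, q k ∈ N k := by
    intro k
    induction k with
    | zero => exact Submodule.zero_mem _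
    | succ k ih =>
      rw [hq]
      have hk := hmono (Nat.le_succ k)
      refine Submodule.add_mem _ (hk ih) (hNr _ _ ?_ _)
      rw [sub_mul, one_mul]
      exact Submodule.sub_mem _ (hpN _) (hk (hNr _ _ ih _))
  have hqx : ∀ k, ∀ x ∈ N k, q k * x = x := by
    intro k
    induction k with
    | zero =>
      intro x hx
      rw [h0, Submodule.mem_bot] at hx
      rw [hx, mul_zero]
    | succ k ih =>
      intro x hx
      have hsub : (1 - q k) * x ∈ N (k + 1) := by
        rw [sub_mul, one_mul]
        exact Submodule.sub_mem _ hx (hmono (Nat.le_succ k) (hNr _ _ (hqN k) _))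
      have hqq := ih _ (hqN k)
      rw [hq, add_mul, mul_assoc, mul_assoc, hpx _ _ hsub, ← mul_assoc]
      have : (1 - q k) * (1 - q k) = 1 - q k := by
        rw [sub_mul, mul_sub, mul_sub, hqq]
        simp
      rw [this, sub_mul, one_mul]
      abel
  refine ⟨q, hq1, hqN, hqx, fun i j hij => ?_⟩
  have hstep : ∀ k, q k * q (k + 1) = q k := by
    intro k
    have hqq := hqx k _ (hqN k)
    have : q k * (1 - q k) = 0 := by rw [mul_sub, hqq, mul_one, sub_self]
    rw [hq, mul_add, hqq, ← mul_assoc, ← mul_assoc, this, zero_mul, zero_mul, add_zero]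
  induction j, hij using Nat.le_induction with
  | base => exact hqx i _ (hqN i)
  | succ j _ ih => rw [← ih, mul_assoc, hstep]

/-- The grading transported along an algebra isomorphism. -/
noncomputable def transport {B : Type*} [Ring B] [Algebra F B] (f : B ≃ₐ[F] A) :
    AlgGrading F B G :=
  ofProj (fun g => (Γ.comp g).comap f.toLinearMap)
    (fun g => f.symm.toLinearMap ∘ₗ Γ.proj g ∘ₗ f.toLinearMap) Γ.supp
    (fun g x => by simpa using Γ.proj_mem g (f x))
    (fun g x hx => by
      have : Γ.proj g (f x) = f x := Γ.proj_of_mem hx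
      simp [this])
    (fun g h hgh x hx => by
      have : Γ.proj h (f x) = 0 := Γ.proj_of_mem_ne hx hgh
      simp [this])
    (fun x => by
      rw [← f.symm_apply_apply x]
      conv_rhs => rw [← Γ.sum_proj (f x), map_sum]
      simp)
    (fun g h x hx y hy => by
      change f (x * y) ∈ Γ.comp (g * h)
      rw [map_mul]
      exact Γ.mul_mem _ _ _ hx _ hy)

variable {Γ} {H : Type*} [CommGroup H] {Θ : AlgGrading F A H}

theorem proj_comm (h : ∀ g, Θ.IsHomog (Γ.comp g)) (g : G) (k : H) (x : A) :
    Γ.proj g (Θ.proj k x) = Θ.proj k (Γ.proj g x) :=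
  (Γ.map_proj Γ (Θ.proj k) (fun g x hx => h g k x hx) g x).symm

variable (Γ Θ) in
/-- The common refinement of two compatible gradings. -/
noncomputable def prod (h : ∀ g, Θ.IsHomog (Γ.comp g)) : AlgGrading F A (G × H) :=
  ofProj (fun gk => Γ.comp gk.1 ⊓ Θ.comp gk.2) (fun gk => Γ.proj gk.1 ∘ₗ Θ.proj gk.2)
    (Γ.supp ×ˢ Θ.supp)
    (fun gk x => ⟨Γ.proj_mem _ _, by
      rw [LinearMap.comp_apply, proj_comm h]
      exact Θ.proj_mem _ _⟩)
    (fun gk x hx => by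
      rw [LinearMap.comp_apply, Θ.proj_of_mem hx.2, Γ.proj_of_mem hx.1])
    (fun gk gk' hne x hx => by
      rw [LinearMap.comp_apply]
      by_cases hg : gk.1 = gk'.1
      · rw [Θ.proj_of_mem_ne hx.2 fun hk => hne (Prod.ext hg hk), map_zero]
      · rw [proj_comm h, Γ.proj_of_mem_ne hx.1 hg, map_zero])
    (fun x => by
      rw [Finset.sum_product]
      simp only [LinearMap.comp_apply]
      rw [Finset.sum_congr rfl fun g _ => (map_sum (Γ.proj g) _ _).symm, Θ.sum_proj,
        Γ.sum_proj])
    (fun gk gk' x hx y hy => ⟨Γ.mul_mem _ _ _ hx.1 _ hy.1, Θ.mul_mem _ _ _ hx.2 _ hy.2⟩)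

theorem iSup_prod_comp_left (h : ∀ g, Θ.IsHomog (Γ.comp g)) (k : H) :
    ⨆ g, (Γ.prod Θ h).comp (g, k) = Θ.comp k := by
  refine le_antisymm (iSup_le fun g => inf_le_right) fun x hx => ?_
  rw [← Γ.sum_proj x]
  refine Submodule.sum_mem _ fun g _ => Submodule.mem_iSup_of_mem g ⟨Γ.proj_mem _ _, ?_⟩
  change Γ.proj g x ∈ Θ.comp k
  rw [Θ.mem_comp_iff, ← proj_comm h, Θ.proj_of_mem hx]

theorem iSup_prod_comp_right (h : ∀ g, Θ.IsHomog (Γ.comp g)) (g : G) :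
    ⨆ k, (Γ.prod Θ h).comp (g, k) = Γ.comp g := by
  refine le_antisymm (iSup_le fun g => inf_le_left) fun x hx => ?_
  rw [← Θ.sum_proj x]
  exact Submodule.sum_mem _ fun k _ =>
    Submodule.mem_iSup_of_mem k ⟨h g k x hx, Θ.proj_mem _ _⟩

end AlgGrading

end Idempotents

section FullMatrixAlgebra

variable {F : Type*} [Field F] {n s : ℕ}

theorem eq_top_of_mul_mem_rightIdeal {S M : Submodule F (Matrix (Fin n) (Fin n) F)}
    (hS : S ≠ ⊥) (hSr : ∀ x ∈ S, ∀ r, x * r ∈ S) (h : ∀ a, ∀ x ∈ S, a * x ∈ M) : M = ⊤ := by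
  obtain ⟨y, hy, hy0⟩ := Submodule.exists_mem_ne_zero_of_ne_bot hS
  obtain ⟨i, j, hij⟩ : ∃ i j, y i j ≠ 0 := by
    by_contra! hcon
    exact hy0 (Matrix.ext hcon)
  rw [eq_top_iff]
  intro x _
  have key : x = ∑ a, ∑ c, single a i (1 : F) * (y * single j c (x a c / y i j)) := by
    refine (matrix_eq_sum_single x).trans ?_
    refine Finset.sum_congr rfl fun a _ => Finset.sum_congr rfl fun c _ => ?_
    ext u v
    rw [single_one_mul_apply, single_apply]
    by_cases hu : u = a
    · subst hu
      by_cases hv : v = c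
      · subst hv
        rw [Matrix.mul_single_apply_same]
        simp [field]
      · rw [Matrix.mul_single_apply_of_ne _ _ _ _ _ hv]
        simp [Ne.symm hv]
    · simp [hu, Ne.symm hu]
  rw [key]
  exact Submodule.sum_mem _ fun a _ => Submodule.sum_mem _ fun c _ => h _ _ (hSr y hy _)

/-- Conjugation by an invertible element. -/
def conjEquiv {A : Type*} [Ring A] [Algebra F A] {P Q : A} (hPQ : P * Q = 1) (hQP : Q * P = 1) :
    A ≃ₐ[F] A where
  toFun x := P * x * Q
  invFun x := Q * x * P
  left_inv x := by
    change Q * (P * x * Q) * P = x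
    rw [mul_assoc, mul_assoc, mul_assoc, hQP, mul_one, ← mul_assoc, hQP, one_mul]
  right_inv x := by
    change P * (Q * x * P) * Q = x
    rw [mul_assoc, mul_assoc, mul_assoc, hPQ, mul_one, ← mul_assoc, hPQ, one_mul]
  map_mul' x y := by
    rw [mul_assoc (P * x), ← mul_assoc Q, ← mul_assoc Q, hQP, one_mul, mul_assoc P x,
      mul_assoc P, mul_assoc x]
  map_add' x y := by rw [mul_add, add_mul]
  commutes' c := by
    rw [← Algebra.commutes, mul_assoc, hPQ, mul_one]

variable (b : Fin n → Fin s)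

/-- The restriction to block triangular matrices of an automorphism of the full matrix algebra. -/
def restrictUTB (Ψ : Matrix (Fin n) (Fin n) F ≃ₐ[F] Matrix (Fin n) (Fin n) F)
    (h : ∀ x ∈ UTB F b, Ψ x ∈ UTB F b) (h' : ∀ x ∈ UTB F b, Ψ.symm x ∈ UTB F b) :
    UTB F b ≃ₐ[F] UTB F b where
  toFun x := ⟨Ψ x, h x x.2⟩
  invFun x := ⟨Ψ.symm x, h' x x.2⟩
  left_inv _ := Subtype.ext (Ψ.symm_apply_apply _)
  right_inv _ := Subtype.ext (Ψ.apply_symm_apply _)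
  map_mul' _ _ := Subtype.ext (map_mul Ψ _ _)
  map_add' _ _ := Subtype.ext (map_add Ψ _ _)
  commutes' c := Subtype.ext (Ψ.commutes c)

variable (F) in
/-- The natural `ℤ`-grading of the matrix algebra by block diagonals. -/
noncomputable def blockGrading : AlgGrading F (Matrix (Fin n) (Fin n) F) (Multiplicative ℤ) :=
  AlgGrading.ofProj (fun m => Jdiag F b m.toAdd)
    (fun m =>
      { toFun := fun x => Matrix.of fun p q => if (b q : ℤ) = b p + m.toAdd then x p q else 0
        map_add' := fun x y => by ext p q; simp; split_ifs <;> simp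
        map_smul' := fun c x => by ext p q; simp })
    ((Finset.Icc (-s : ℤ) s).map Multiplicative.ofAdd.toEmbedding)
    (fun m x p q h => if_neg h)
    (fun m x hx => by
      ext p q
      change (if (b q : ℤ) = b p + m.toAdd then x p q else 0) = x p q
      split_ifs with h
      · rfl
      · exact (hx p q h).symm)
    (fun m k hmk x hx => by
      ext p q
      change (if (b q : ℤ) = b p + k.toAdd then x p q else 0) = 0
      split_ifs with h
      · refine hx p q fun h' => hmk (Multiplicative.toAdd.injective ?_)
        linarith
      · rfl)
    (fun x => by
      ext p q
      rw [Matrix.sum_apply, Finset.sum_map, Finset.sum_eq_single ((b q : ℤ) - b p)]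
      · change (if (b q : ℤ) = b p + ((b q : ℤ) - b p) then x p q else 0) = x p q
        rw [if_pos (by ring)]
      · intro m _ hm
        change (if (b q : ℤ) = b p + m then x p q else 0) = 0
        rw [if_neg]
        intro h
        exact hm (by linarith)
      · intro h
        exfalso
        apply h
        have := (b p).2
        have := (b q).2
        rw [Finset.mem_Icc]
        constructor <;> omega)
    (fun m k x hx y hy p q h => by
      rw [mul_apply]
      refine Finset.sum_eq_zero fun t _ => ?_
      by_cases ht : (b t : ℤ) = b p + m.toAdd
      · rw [hy t q, mul_zero]
        rw [ht]
        intro h'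
        apply h
        rw [h', toAdd_mul, add_assoc]
      · rw [hx p t ht, zero_mul])

end FullMatrixAlgebra

section Surjectivity

variable {F : Type*} [Field F] {n s : ℕ} {b : Fin n → Fin s}

theorem exists_inverse_mem_UTB (hb : Monotone b) {P : Matrix (Fin n) (Fin n) F}
    (hP : ∀ i j, b j ≤ b i → P i j = if i = j then 1 else 0) :
    P ∈ UTB F b ∧ ∃ Q ∈ UTB F b, P * Q = 1 ∧ Q * P = 1 := by
  have hPU : P ∈ UTB F b := by
    rw [mem_UTB]
    intro i j h
    rw [hP i j h.le, if_neg]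
    rintro rfl
    exact lt_irrefl _ h
  have hdet : P.det = 1 := by
    rw [det_of_isUpperTriangular]
    · exact Finset.prod_eq_one fun i _ => by rw [hP i i le_rfl, if_pos rfl]
    · intro i j h
      have h : j < i := h
      rw [hP i j (hb h.le), if_neg h.ne']
  have hu : IsUnit P.det := hdet ▸ isUnit_one
  let := invertibleOfIsUnitDet P hu
  exact ⟨hPU, P⁻¹, blockTriangular_inv_of_blockTriangular hPU, mul_nonsing_inv P hu,
    nonsing_inv_mul P hu⟩

variable (F b) in
/-- The diagonal idempotent onto the first `k` blocks. -/
def blockIdempotent (k : ℕ) : Matrix (Fin n) (Fin n) F :=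
  diagonal fun i => if (b i : ℕ) < k then 1 else 0

variable {G : Type*} [CommGroup G]

theorem isHomog_Jdiag {Θ : AlgGrading F (Matrix (Fin n) (Fin n) F) G}
    (h : ∀ k, blockIdempotent F b k ∈ Θ.comp 1) (m : ℤ) : Θ.IsHomog (Jdiag F b m) := by
  intro g x hx p q hpq
  let e : Fin n → Matrix (Fin n) (Fin n) F := fun i =>
    blockIdempotent F b (b i + 1) - blockIdempotent F b (b i)
  have he : ∀ i, e i ∈ Θ.comp 1 := fun i => Submodule.sub_mem _ (h _) (h _)
  have hed : ∀ i, e i = diagonal fun t => if b t = b i then 1 else 0 := by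
    intro i
    simp only [e, blockIdempotent, diagonal_sub]
    congr 1
    ext t
    by_cases ht : b t = b i
    · simp [ht]
    · have : (b t : ℕ) ≠ b i := fun h => ht (Fin.ext h)
      rw [if_neg ht]
      by_cases h' : (b t : ℕ) < b i
      · rw [if_pos h', if_pos (by omega), sub_self]
      · rw [if_neg h', if_neg (by omega), sub_self]
  have hent : ∀ (y : Matrix (Fin n) (Fin n) F) (u v : Fin n),
      (e p * y * e q) u v = if b u = b p ∧ b v = b q then y u v else 0 := by
    intro y u v
    rw [hed, hed, mul_diagonal, diagonal_mul]
    by_cases hu : b u = b p <;> by_cases hv : b v = b q <;> simp [hu, hv]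
  have h0 : e p * x * e q = 0 := by
    ext u v
    rw [hent]
    split_ifs with huv
    · exact hx u v (by rw [huv.1, huv.2]; exact hpq)
    · rfl
  have h1 := Θ.proj_mul_left (he p) g x
  have h2 := Θ.proj_mul_right (he q) (1 * g) (e p * x)
  rw [h1, h0, map_zero] at h2
  have := hent (Θ.proj g x) p q
  rw [← h2, if_pos ⟨rfl, rfl⟩] at this
  exact this.symm

/-- A grading of block triangular matrices becomes, after conjugation by a block triangular
matrix, a coarsening of a grading compatible with the natural one. -/
theorem exists_conj_blockIdempotent_mem {l : Fin n} (hb : Monotone b)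
    (hs : Function.Surjective b) (hl : ∀ j, b j ≤ b l) (Δ : AlgGrading F (UTB F b) G) :
    ∃ P ∈ UTB F b, ∃ Q ∈ UTB F b, P * Q = 1 ∧ Q * P = 1 ∧ ∀ k,
      P * blockIdempotent F b k * Q ∈
        (extendGrading hl Δ (isHomog_lastColumn Δ hs hl)).comp 1 := by
  set E := extendGrading hl Δ (isHomog_lastColumn Δ hs hl)
  have hmono : Monotone (rowIdeal F b) := fun k k' hk x hx i j h => hx i j (hk.trans h)
  have htop : ∀ k, s ≤ k → rowIdeal F b k = ⊤ := by
    intro k hk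
    rw [eq_top_iff]
    intro x _ i j h
    have := (b i).2
    omega
  have hhom : ∀ k, E.IsHomog (rowIdeal F b k) := by
    intro k
    rcases le_total k s with hk | hk
    · exact isHomog_rowIdeal hl Δ _ (isHomog_rowsBelow Δ hs hl hk)
    · rw [htop k hk]
      exact AlgGrading.isHomog_top
  obtain ⟨q, hq1, hqN, hqx, hqq⟩ := E.exists_idempotents hmono
    (eq_bot_iff.2 fun x hx => Matrix.ext fun i j => hx i j (Nat.zero_le _))
    (fun k x hx r => rowIdeal_mul_mem hx r) (fun k => by
      obtain ⟨K, hK, hKr, h1, h2⟩ := E.exists_homogeneous_complement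
        (fun S M => eq_top_of_mul_mem_rightIdeal) (hhom k) fun x hx r => rowIdeal_mul_mem hx r
      exact E.exists_leftIdentity_mem_comp_one (hhom k) (fun x hx r => rowIdeal_mul_mem hx r)
        hK hKr h1 h2)
  have hcol : ∀ k i j, (b j : ℕ) < k → q k i j = if i = j then 1 else 0 := by
    intro k i j hj
    have := hqx k (single j j 1) fun u v hu => by
      rw [single_apply, if_neg]
      rintro ⟨rfl, rfl⟩
      omega
    have := congrFun (congrFun this i) j
    rw [mul_single_one_apply, if_pos rfl, single_apply] at this
    rw [this]
    simp [eq_comm]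
  obtain ⟨P, hP⟩ : ∃ P : Matrix (Fin n) (Fin n) F,
      ∀ i j, P i j = (q (b j + 1) - q (b j)) i j := ⟨Matrix.of fun i j => _, fun i j => rfl⟩
  obtain ⟨hPU, Q, hQU, hPQ, hQP⟩ := exists_inverse_mem_UTB (F := F) hb (P := P) fun i j h => by
    rw [hP, Matrix.sub_apply, hqN (b j) i j (Fin.le_def.1 h), sub_zero,
      hcol _ _ _ (Nat.lt_succ_self _)]
  refine ⟨P, hPU, Q, hQU, hPQ, hQP, fun k => ?_⟩
  have hqP : P * blockIdempotent F b k = q k * P := by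
    ext i j
    have h1 : (q k * P) i j = (q k * (q (b j + 1) - q (b j))) i j := by
      rw [mul_apply, mul_apply]
      exact Finset.sum_congr rfl fun t _ => by rw [hP]
    rw [h1, blockIdempotent, mul_diagonal, mul_sub]
    by_cases hj : (b j : ℕ) < k
    · rw [if_pos hj, mul_one, hqx k _ (hmono hj (hqN _)), hqx k _ (hmono hj.le (hqN _)), hP]
    · rw [if_neg hj, mul_zero, hqq _ _ (by omega), hqq _ _ (by omega), sub_self]
      rfl
  rw [hqP, mul_assoc, hPQ, mul_one]
  exact hq1 k

theorem exists_admissible_lift {l : Fin n} (hb : Monotone b)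
    (hs : Function.Surjective b) (hl : ∀ j, b j ≤ b l) (Δ : AlgGrading F (UTB F b) G) :
    ∃ Γ : AlgGrading F (Matrix (Fin n) (Fin n) F) (Multiplicative ℤ × G),
      Admissible b Γ ∧ ∃ ψ : UTB F b ≃ₐ[F] UTB F b,
        ∀ g, (inducedComp b Γ g).map ψ.toLinearMap = Δ.comp g := by
  obtain ⟨P, hP, Q, hQ, hPQ, hQP, hk⟩ := exists_conj_blockIdempotent_mem hb hs hl Δ
  set E := extendGrading hl Δ (isHomog_lastColumn Δ hs hl)
  let Ψ : Matrix (Fin n) (Fin n) F ≃ₐ[F] Matrix (Fin n) (Fin n) F := conjEquiv hPQ hQP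
  have hJ : ∀ m, (E.transport Ψ).IsHomog ((blockGrading F b).comp m) := fun m =>
    isHomog_Jdiag hk m.toAdd
  refine ⟨(blockGrading F b).prod (E.transport Ψ) hJ, fun m _ => ?_, ?_⟩
  · rw [AlgGrading.iSup_prod_comp_right]
    exact le_rfl
  let ψ : UTB F b ≃ₐ[F] UTB F b := restrictUTB b Ψ
    (fun x hx => (UTB F b).mul_mem ((UTB F b).mul_mem hP hx) hQ)
    (fun x hx => (UTB F b).mul_mem ((UTB F b).mul_mem hQ hx) hP)
  refine ⟨ψ, fun g => ?_⟩
  have hmem : ∀ x, x ∈ inducedComp b ((blockGrading F b).prod (E.transport Ψ) hJ) g ↔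
      ψ x ∈ Δ.comp g := by
    intro x
    rw [← coe_mem_extendGrading hl Δ (isHomog_lastColumn Δ hs hl), inducedComp]
    have : ⨆ m : ℤ, ((blockGrading F b).prod (E.transport Ψ) hJ).comp (Multiplicative.ofAdd m, g)
        = (E.transport Ψ).comp g := AlgGrading.iSup_prod_comp_left hJ g
    rw [this]
    exact Iff.rfl
  ext y
  refine ⟨?_, fun hy => ⟨ψ.symm y, (hmem _).2 ?_, ψ.apply_symm_apply y⟩⟩
  · rintro ⟨x, hx, rfl⟩
    exact (hmem x).1 hx
  · rwa [ψ.apply_symm_apply]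

end Surjectivity

section Isomorphisms

namespace AlgGrading

variable {F : Type*} [Field F] {A : Type*} [Ring A] [Algebra F A] {H : Type*} [CommGroup H]
  [LinearOrder H] [IsOrderedMonoid H] (Γ : AlgGrading F A H) [FiniteDimensional F A]

theorem proj_mul_of_forall_lt {a c : H} {x y : A} (hx : ∀ k < a, Γ.proj k x = 0)
    (hy : ∀ k < c, Γ.proj k y = 0) : Γ.proj (a * c) (x * y) = Γ.proj a x * Γ.proj c y := by
  have h : ∀ k, Γ.proj (a * c) (Γ.proj k x * y) = Γ.proj k x * Γ.proj (k⁻¹ * (a * c)) y := by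
    intro k
    have := Γ.proj_mul_left (Γ.proj_mem k x) (k⁻¹ * (a * c)) y
    rwa [mul_inv_cancel_left] at this
  conv_lhs => rw [← Γ.sum_proj x, Finset.sum_mul, map_sum]
  rw [Finset.sum_eq_single a]
  · rw [h, inv_mul_cancel_left]
  · intro k _ hk
    rw [h]
    rcases lt_or_gt_of_ne hk with hk | hk
    · rw [hx k hk, zero_mul]
    · rw [hy, mul_zero]
      rw [inv_mul_lt_iff_lt_mul]
      exact mul_lt_mul_left hk c
  · intro ha
    simp [Γ.proj_eq_zero_of_notMem_supp ha]

theorem proj_mul_eq_zero_of_forall_lt {a c : H} {x y : A} (hx : ∀ k < a, Γ.proj k x = 0)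
    (hy : ∀ k < c, Γ.proj k y = 0) : ∀ k < a * c, Γ.proj k (x * y) = 0 := by
  intro k hk
  conv_lhs => rw [← Γ.sum_proj x, Finset.sum_mul, map_sum]
  refine Finset.sum_eq_zero fun j _ => ?_
  have := Γ.proj_mul_left (Γ.proj_mem j x) (j⁻¹ * k) y
  rw [mul_inv_cancel_left] at this
  rw [this]
  rcases lt_or_ge j a with hj | hj
  · rw [hx j hj, zero_mul]
  · rw [hy, mul_zero]
    rw [inv_mul_lt_iff_lt_mul]
    exact hk.trans_le (mul_le_mul_left hj c)

end AlgGrading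

variable {F : Type*} [Field F] {n s : ℕ} {b : Fin n → Fin s}

theorem map_eq_zero_of_mem_UTB {W : Type*} [AddCommGroup W] [Module F W]
    (f : Matrix (Fin n) (Fin n) F →ₗ[F] W) (hf : ∀ i j, b i ≤ b j → f (single i j 1) = 0)
    {x : Matrix (Fin n) (Fin n) F} (hx : x ∈ UTB F b) : f x = 0 := by
  rw [matrix_eq_sum_single x, map_sum]
  refine Finset.sum_eq_zero fun i _ => ?_
  rw [map_sum]
  refine Finset.sum_eq_zero fun j _ => ?_
  rcases le_or_gt (b i) (b j) with h | h
  · have : single i j (x i j) = x i j • single i j (1 : F) := by simp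
    rw [this, map_smul, hf i j h, smul_zero]
  · rw [(mem_UTB b).1 hx i j h, single_zero, map_zero]

theorem single_mem_Jdiag (i j : Fin n) (c : F) : single i j c ∈ Jdiag F b ((b j : ℤ) - b i) := by
  intro p q h
  rw [single_apply, if_neg]
  rintro ⟨rfl, rfl⟩
  exact h (by ring)

theorem mem_UTB_of_mem_Jdiag {m : ℤ} (hm : 0 ≤ m) {x : Matrix (Fin n) (Fin n) F}
    (hx : x ∈ Jdiag F b m) : x ∈ UTB F b := by
  rw [mem_UTB]
  intro i j h
  refine hx i j ?_
  have := Fin.lt_def.1 h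
  omega

theorem blockGrading_proj_eq_zero {x : Matrix (Fin n) (Fin n) F} (hx : x ∈ UTB F b) :
    ∀ k < 1, (blockGrading F b).proj k x = 0 := by
  intro k hk
  refine map_eq_zero_of_mem_UTB _ (fun i j hij => ?_) hx
  have : single i j (1 : F) ∈ (blockGrading F b).comp (Multiplicative.ofAdd ((b j : ℤ) - b i)) :=
    single_mem_Jdiag i j 1
  refine (blockGrading F b).proj_of_mem_ne this fun h => ?_
  have h1 : (b j : ℤ) - b i = k.toAdd := congrArg Multiplicative.toAdd h
  have h2 : k.toAdd < 0 := hk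
  have := Fin.le_def.1 hij
  omega

variable {G : Type*} [CommGroup G]

namespace Admissible

variable {Γ : AlgGrading F (Matrix (Fin n) (Fin n) F) (Multiplicative ℤ × G)}

theorem comp_le (hΓ : Admissible b Γ) {l : Fin n} (hl : ∀ j, b j ≤ b l)
    (m : Multiplicative ℤ) (g : G) : Γ.comp (m, g) ≤ Jdiag F b m.toAdd := by
  let M : ℤ → Submodule F (Matrix (Fin n) (Fin n) F) := fun a =>
    ⨆ g, Γ.comp (Multiplicative.ofAdd a, g)
  have hM : ∀ a c, ∀ x ∈ M a, ∀ y ∈ M c, x * y ∈ M (a + c) := by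
    intro a c x hx y hy
    have hle : M a * M c ≤ M (a + c) := by
      simp only [M, Submodule.iSup_mul, Submodule.mul_iSup]
      refine iSup_le fun g => iSup_le fun h => Submodule.mul_le.2 fun x hx y hy => ?_
      exact Submodule.mem_iSup_of_mem _ (Γ.mul_mem _ _ _ hx _ hy)
    exact hle (Submodule.mul_mem_mul hx hy)
  have hdisj : ∀ a c, ∀ x ∈ M a, x ∈ M c → x ≠ 0 → a = c := by
    intro a c x ha hc hx
    by_contra hac
    rw [AlgGrading.mem_iSup_comp_iff] at ha hc
    refine hx (Γ.eq_zero_of_proj fun k => ?_)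
    by_cases hk : k ∈ Set.range fun g : G => (Multiplicative.ofAdd a, g)
    · refine hc k ?_
      obtain ⟨g, rfl⟩ := hk
      rintro ⟨h, hh⟩
      exact hac (congrArg (fun u : Multiplicative ℤ × G => u.1.toAdd) hh).symm
    · exact ha k hk
  have hE : ∀ i j, b i ≤ b j → ∀ c : F, single i j c ∈ M ((b j : ℤ) - b i) := by
    intro i j h c
    have := Fin.le_def.1 h
    exact hΓ _ (by omega) (single_mem_Jdiag i j c)
  intro x hx i j hij
  by_contra hne
  have hxM : x ∈ M m.toAdd := Submodule.mem_iSup_of_mem g hx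
  have h1 := hM _ _ _ (hM _ _ _ (hE i i le_rfl 1) _ hxM) _ (hE j l (hl j) 1)
  have h2 : single i i 1 * x * single j l 1 = single i l (x i j) := by
    ext u v
    rw [mul_single_one_apply, single_one_mul_apply, single_apply]
    by_cases hu : u = i <;> by_cases hv : v = l <;>
      simp [hu, hv, eq_comm (a := i), eq_comm (a := l)]
  rw [h2] at h1
  have h3 := hdisj _ _ _ h1 (hE i l (hl i) _) fun h => hne (by
    simpa using congrFun (congrFun h i) l)
  apply hij
  linarith

theorem Jdiag_le (hΓ : Admissible b Γ) {l : Fin n} (hl : ∀ j, b j ≤ b l)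
    (m : Multiplicative ℤ) : Jdiag F b m.toAdd ≤ ⨆ g, Γ.comp (m, g) := by
  intro x hx
  have hx : (blockGrading F b).proj m x = x := (blockGrading F b).proj_of_mem hx
  rw [← hx, ← Γ.sum_proj x, map_sum]
  refine Submodule.sum_mem _ fun k _ => ?_
  have hk : Γ.proj k x ∈ (blockGrading F b).comp k.1 := hΓ.comp_le hl k.1 k.2 (Γ.proj_mem k x)
  by_cases hkm : k.1 = m
  · subst hkm
    rw [(blockGrading F b).proj_of_mem hk]
    exact Submodule.mem_iSup_of_mem k.2 (Γ.proj_mem k x)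
  · rw [(blockGrading F b).proj_of_mem_ne hk hkm]
    exact Submodule.zero_mem _

theorem proj_eq_zero (hΓ : Admissible b Γ) {l : Fin n} (hl : ∀ j, b j ≤ b l)
    {m : Multiplicative ℤ} {x : Matrix (Fin n) (Fin n) F} (hx : x ∈ Jdiag F b m.toAdd)
    {k : Multiplicative ℤ × G} (hk : k.1 ≠ m) : Γ.proj k x = 0 := by
  refine (Γ.mem_iSup_comp_iff _).1 (hΓ.Jdiag_le hl m hx) k ?_
  rintro ⟨g, rfl⟩
  exact hk rfl

theorem blockGrading_proj (hΓ : Admissible b Γ) {l : Fin n} (hl : ∀ j, b j ≤ b l)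
    (m : Multiplicative ℤ) (g : G) {x : Matrix (Fin n) (Fin n) F}
    (hx : x ∈ ⨆ k : ℤ, Γ.comp (Multiplicative.ofAdd k, g)) :
    (blockGrading F b).proj m x ∈ Γ.comp (m, g) := by
  rw [← Γ.sum_proj x, map_sum]
  refine Submodule.sum_mem _ fun k _ => ?_
  have hk : Γ.proj k x ∈ (blockGrading F b).comp k.1 := hΓ.comp_le hl k.1 k.2 (Γ.proj_mem k x)
  by_cases hkm : k.1 = m
  · rw [← hkm, (blockGrading F b).proj_of_mem hk]
    by_cases hkg : k.2 = g
    · rw [← hkg]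
      exact Γ.proj_mem k x
    · rw [(Γ.mem_iSup_comp_iff _).1 hx k]
      · exact Submodule.zero_mem _
      · rintro ⟨a, rfl⟩
        exact hkg rfl
  · rw [(blockGrading F b).proj_of_mem_ne hk hkm]
    exact Submodule.zero_mem _

theorem mem_UTB_iff (hΓ : Admissible b Γ) {l : Fin n} (hl : ∀ j, b j ≤ b l)
    {x : Matrix (Fin n) (Fin n) F} :
    x ∈ UTB F b ↔ ∀ k : Multiplicative ℤ × G, k.1 < 1 → Γ.proj k x = 0 := by
  refine ⟨fun hx k hk => map_eq_zero_of_mem_UTB _ (fun i j hij => ?_) hx, fun h => ?_⟩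
  · refine hΓ.proj_eq_zero hl (m := Multiplicative.ofAdd ((b j : ℤ) - b i))
      (single_mem_Jdiag i j 1) fun h => ?_
    have h1 : k.1.toAdd = (b j : ℤ) - b i := congrArg Multiplicative.toAdd h
    have h2 : k.1.toAdd < 0 := hk
    have := Fin.le_def.1 hij
    omega
  · rw [← Γ.sum_proj x]
    refine (UTB F b).sum_mem fun k _ => ?_
    rcases lt_or_ge k.1 1 with hk | hk
    · rw [h k hk]
      exact (UTB F b).zero_mem
    · exact mem_UTB_of_mem_Jdiag hk (hΓ.comp_le hl k.1 k.2 (Γ.proj_mem k x))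

end Admissible

variable {Γ₁ Γ₂ : AlgGrading F (Matrix (Fin n) (Fin n) F) (Multiplicative ℤ × G)}

theorem exists_inducedComp_equiv (h₁ : Admissible b Γ₁) (h₂ : Admissible b Γ₂) {l : Fin n}
    (hl : ∀ j, b j ≤ b l) (h : AlgGrading.Iso Γ₁ Γ₂) :
    ∃ ψ : UTB F b ≃ₐ[F] UTB F b,
      ∀ g : G, (inducedComp b Γ₁ g).map ψ.toLinearMap = inducedComp b Γ₂ g := by
  obtain ⟨Ψ, hΨ⟩ := h
  have hproj : ∀ k x, Γ₂.proj k (Ψ x) = Ψ (Γ₁.proj k x) := fun k x =>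
    (Γ₁.map_proj Γ₂ Ψ.toLinearMap (fun g x hx => hΨ g ▸ Submodule.mem_map_of_mem hx) k x).symm
  have hU : ∀ x, Ψ x ∈ UTB F b ↔ x ∈ UTB F b := by
    intro x
    rw [h₂.mem_UTB_iff hl, h₁.mem_UTB_iff hl]
    simp only [hproj, map_eq_zero_iff Ψ Ψ.injective]
  let ψ : UTB F b ≃ₐ[F] UTB F b := restrictUTB b Ψ (fun x hx => (hU x).2 hx)
    (fun x hx => (hU _).1 (by rwa [Ψ.apply_symm_apply]))
  have hmem : ∀ g x, ψ x ∈ inducedComp b Γ₂ g ↔ x ∈ inducedComp b Γ₁ g := by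
    intro g x
    change Ψ (x : Matrix (Fin n) (Fin n) F) ∈ ⨆ m : ℤ, Γ₂.comp (Multiplicative.ofAdd m, g) ↔
      (x : Matrix (Fin n) (Fin n) F) ∈ ⨆ m : ℤ, Γ₁.comp (Multiplicative.ofAdd m, g)
    rw [Γ₂.mem_iSup_comp_iff, Γ₁.mem_iSup_comp_iff]
    simp only [hproj, map_eq_zero_iff Ψ Ψ.injective]
  refine ⟨ψ, fun g => ?_⟩
  ext y
  refine ⟨?_, fun hy => ⟨ψ.symm y, (hmem g _).1 ?_, ψ.apply_symm_apply y⟩⟩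
  · rintro ⟨x, hx, rfl⟩
    exact (hmem g x).2 hx
  · rwa [ψ.apply_symm_apply]

end Isomorphisms

section Automorphisms

variable {F : Type*} [Field F] {n s : ℕ} {b : Fin n → Fin s}

/-- A vector subspace from the standard flag preserved by block triangular matrices. -/
def flagSubspace (F : Type*) [Field F] (b : Fin n → Fin s) (t : Fin s) :
    Submodule F (Fin n → F) where
  carrier := {v | ∀ i, t < b i → v i = 0}
  add_mem' {v w} hv hw i h := by simp [hv i h, hw i h]
  zero_mem' i _ := rfl
  smul_mem' c v hv i h := by simp [hv i h]

theorem flagSubspace_lt {i j : Fin n} (h : b j < b i) :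
    flagSubspace F b (b j) < flagSubspace F b (b i) := by
  refine lt_of_le_of_ne (fun v hv t ht => hv t (h.trans ht)) fun he => ?_
  have : Pi.single i (1 : F) ∈ flagSubspace F b (b i) := fun t ht => by
    rw [Pi.single_eq_of_ne]
    rintro rfl
    exact lt_irrefl _ ht
  rw [← he] at this
  simpa using this i h

/-- If conjugation by an invertible matrix maps block triangular matrices to block triangular
matrices, then the matrix is itself block triangular. -/
theorem mem_UTB_of_conj_mem {P Q : Matrix (Fin n) (Fin n) F} (hPQ : P * Q = 1)
    (h : ∀ x ∈ UTB F b, Q * x * P ∈ UTB F b) : P ∈ UTB F b := by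
  rw [mem_UTB]
  intro i j hij
  by_contra hne
  have hQ : ∀ r u, b u ≤ b i → b j < b r → Q r u = 0 := by
    intro r u hu hr
    have h1 := (mem_UTB b).1 (h _ (single_mem_UTB b hu 1)) r j hr
    rw [mul_assoc, mul_apply, Finset.sum_eq_single u] at h1
    · rw [single_one_mul_apply, if_pos rfl] at h1
      exact (mul_eq_zero.1 h1).resolve_right hne
    · intro t _ ht
      rw [single_one_mul_apply, if_neg ht, mul_zero]
    · simp
  have hinj : Function.Injective (Q.mulVecLin) := by
    intro v w hvw
    have := congrArg (fun u => P *ᵥ u) hvw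
    simpa [mulVec_mulVec, hPQ] using this
  have hmap : (flagSubspace F b (b i)).map Q.mulVecLin ≤ flagSubspace F b (b j) := by
    rintro _ ⟨v, hv, rfl⟩ r hr
    rw [mulVecLin_apply, mulVec, dotProduct]
    refine Finset.sum_eq_zero fun u _ => ?_
    rcases le_or_gt (b u) (b i) with hu | hu
    · rw [hQ r u hu hr, zero_mul]
    · rw [hv u hu, mul_zero]
  have h1 := Submodule.finrank_mono hmap
  rw [← (Submodule.equivMapOfInjective _ hinj _).finrank_eq] at h1
  exact absurd (Submodule.finrank_lt_finrank_of_lt (flagSubspace_lt (F := F) hij)) (not_lt.2 h1)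

theorem exists_conj_of_equiv {z l : Fin n} (hz : ∀ j, b z ≤ b j) (hl : ∀ j, b j ≤ b l)
    (ψ : UTB F b ≃ₐ[F] UTB F b) :
    ∃ P ∈ UTB F b, ∃ Q ∈ UTB F b, P * Q = 1 ∧ Q * P = 1 ∧
      ∀ x : UTB F b, (ψ x : Matrix (Fin n) (Fin n) F) = P * x * Q := by
  obtain ⟨r, c, hrc⟩ : ∃ r c, (ψ (unitUTB F b z l) : Matrix (Fin n) (Fin n) F) r c ≠ 0 := by
    by_contra! hcon
    have h0 : ψ (unitUTB F b z l) = 0 := Subtype.ext (Matrix.ext hcon)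
    rw [map_eq_zero_iff ψ ψ.injective] at h0
    have := congrFun (congrFun (congrArg Subtype.val h0) z) l
    rw [coe_unitUTB b (hz l), single_apply_same] at this
    exact one_ne_zero this
  obtain ⟨P, hP⟩ : ∃ P : Matrix (Fin n) (Fin n) F, ∀ i j,
      P i j = (ψ (unitUTB F b j l) : Matrix (Fin n) (Fin n) F) i c :=
    ⟨Matrix.of fun i j => _, fun i j => rfl⟩
  have hψP : ∀ y : UTB F b, (ψ y : Matrix (Fin n) (Fin n) F) * P = P * y := by
    intro y
    ext i j
    have h1 : ψ y * ψ (unitUTB F b j l) =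
        ∑ t, (y : Matrix (Fin n) (Fin n) F) t j • ψ (unitUTB F b t l) := by
      rw [← map_mul, mul_unitUTB hl, map_sum]
      exact Finset.sum_congr rfl fun t _ => map_smul ψ _ _
    have h2 := congrFun (congrFun (congrArg Subtype.val h1) i) c
    rw [MulMemClass.coe_mul, AddSubmonoidClass.coe_finsetSum, Matrix.sum_apply, mul_apply] at h2
    rw [mul_apply, mul_apply]
    simp only [hP]
    rw [h2]
    exact Finset.sum_congr rfl fun t _ => mul_comm _ _
  have hdet : IsUnit P.det := by
    rw [isUnit_iff_ne_zero]
    intro h0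
    obtain ⟨v, hv, hPv⟩ := exists_mulVec_eq_zero_iff.2 h0
    apply hv
    ext i
    have h1 : (P * (unitUTB F b z i : Matrix (Fin n) (Fin n) F)) *ᵥ v = 0 := by
      rw [← hψP, ← mulVec_mulVec, hPv, mulVec_zero]
    have h2 := congrFun h1 r
    rw [coe_unitUTB b (hz i), mulVec, dotProduct, Finset.sum_eq_single i] at h2
    · rw [mul_single_one_apply, if_pos rfl, hP] at h2
      exact (mul_eq_zero.1 h2).resolve_left hrc
    · intro t _ ht
      rw [mul_single_one_apply, if_neg ht, zero_mul]
    · simp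
  have hPQ := mul_nonsing_inv P hdet
  have hQP := nonsing_inv_mul P hdet
  have hψ : ∀ x : UTB F b, (ψ x : Matrix (Fin n) (Fin n) F) = P * x * P⁻¹ := fun x => by
    rw [← hψP, mul_assoc, hPQ, mul_one]
  refine ⟨P, ?_, P⁻¹, ?_, hPQ, hQP, hψ⟩
  · refine mem_UTB_of_conj_mem hPQ fun x hx => ?_
    have := hψ (ψ.symm ⟨x, hx⟩)
    rw [ψ.apply_symm_apply] at this
    change x = _ at this
    rw [this, mul_assoc, mul_assoc, hQP, mul_one, ← mul_assoc, hQP, one_mul]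
    exact (ψ.symm ⟨x, hx⟩).2
  · refine mem_UTB_of_conj_mem hQP fun x hx => ?_
    rw [← hψ ⟨x, hx⟩]
    exact (ψ ⟨x, hx⟩).2

variable {G : Type*} [CommGroup G]
  {Γ₁ Γ₂ : AlgGrading F (Matrix (Fin n) (Fin n) F) (Multiplicative ℤ × G)}

theorem iso_of_inducedComp_equiv (h₁ : Admissible b Γ₁) (h₂ : Admissible b Γ₂) {z l : Fin n}
    (hz : (b z : ℕ) = 0) (hl : ∀ j, b j ≤ b l) (ψ : UTB F b ≃ₐ[F] UTB F b)
    (hψ : ∀ g : G, (inducedComp b Γ₁ g).map ψ.toLinearMap = inducedComp b Γ₂ g) :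
    AlgGrading.Iso Γ₁ Γ₂ := by
  have hzle : ∀ j, b z ≤ b j := fun j => Fin.le_def.2 (by omega)
  obtain ⟨P, hP, Q, hQ, hPQ, hQP, hconj⟩ := exists_conj_of_equiv hzle hl ψ
  let B := blockGrading F b
  have hP0 := blockGrading_proj_eq_zero hP
  have hQ0 := blockGrading_proj_eq_zero hQ
  have hd : B.proj 1 P * B.proj 1 Q = 1 := by
    rw [← B.proj_mul_of_forall_lt hP0 hQ0, hPQ, one_mul, B.proj_of_mem B.one_mem]
  have hd' : B.proj 1 Q * B.proj 1 P = 1 := by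
    rw [← B.proj_mul_of_forall_lt hQ0 hP0, hQP, one_mul, B.proj_of_mem B.one_mem]
  let Ψ : Matrix (Fin n) (Fin n) F ≃ₐ[F] Matrix (Fin n) (Fin n) F := conjEquiv hd hd'
  have hΨJ : ∀ m, ∀ x ∈ B.comp m, Ψ x ∈ B.comp m := by
    intro m x hx
    have := B.mul_mem _ _ _ (B.mul_mem _ _ _ (B.proj_mem 1 P) _ hx) _ (B.proj_mem 1 Q)
    rwa [one_mul, mul_one] at this
  have hΨJ' : ∀ m, ∀ x ∈ B.comp m, Ψ.symm x ∈ B.comp m := by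
    intro m x hx
    have := B.mul_mem _ _ _ (B.mul_mem _ _ _ (B.proj_mem 1 Q) _ hx) _ (B.proj_mem 1 P)
    rwa [one_mul, mul_one] at this
  have hΨ : ∀ m, ∀ x ∈ B.comp m, Ψ x = B.proj m (P * x * Q) := by
    intro m x hx
    have hx0 : ∀ k < m, B.proj k x = 0 := fun k hk => B.proj_of_mem_ne hx hk.ne'
    have h1 := B.proj_mul_of_forall_lt hP0 hx0
    have h2 := B.proj_mul_of_forall_lt (B.proj_mul_eq_zero_of_forall_lt hP0 hx0) hQ0
    rw [h1, one_mul, mul_one, B.proj_of_mem hx] at h2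
    exact h2.symm
  have hpos : ∀ m g, 1 ≤ m → ∀ x ∈ Γ₁.comp (m, g), Ψ x ∈ Γ₂.comp (m, g) := by
    intro m g hm x hx
    have hxJ := h₁.comp_le hl m g hx
    have hxU : x ∈ UTB F b := mem_UTB_of_mem_Jdiag hm hxJ
    have hxi : (⟨x, hxU⟩ : UTB F b) ∈ inducedComp b Γ₁ g :=
      Submodule.mem_iSup_of_mem (p := fun m : ℤ => Γ₁.comp (Multiplicative.ofAdd m, g)) m.toAdd hx
    have hy : ψ ⟨x, hxU⟩ ∈ inducedComp b Γ₂ g := hψ g ▸ Submodule.mem_map_of_mem hxi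
    rw [hΨ m x hxJ, ← hconj ⟨x, hxU⟩]
    exact h₂.blockGrading_proj hl m g hy
  have hzero : ∀ x : Matrix (Fin n) (Fin n) F, (∀ i, single z i 1 * x = 0) → x = 0 := by
    intro x hx
    ext i j
    have := congrFun (congrFun (hx i) z) j
    rwa [single_one_mul_apply, if_pos rfl] at this
  refine ⟨Ψ, fun k => Γ₁.map_comp_eq Γ₂ Ψ (fun k x hx => ?_) k⟩
  obtain ⟨m, g⟩ := k
  rcases le_or_gt 1 m with hm | -
  · exact hpos m g hm x hx
  have hΨx : Ψ x ∈ B.comp m := hΨJ m x (h₁.comp_le hl m g hx)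
  refine Γ₂.mem_comp_of_proj fun k hk => ?_
  by_cases hkm : k.1 = m
  swap
  · exact h₂.proj_eq_zero hl hΨx hkm
  refine hzero _ fun i => ?_
  let a : Multiplicative ℤ := Multiplicative.ofAdd (b i : ℤ)
  have ha : 1 ≤ a := by
    change (0 : ℤ) ≤ b i
    positivity
  rcases lt_or_ge (a * m) 1 with ham | ham
  · ext u v
    rw [single_one_mul_apply]
    split_ifs
    · have hw : Γ₂.proj k (Ψ x) ∈ Jdiag F b m.toAdd :=
        hkm ▸ h₂.comp_le hl k.1 k.2 (Γ₂.proj_mem k _)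
      refine hw i v fun h => ?_
      have ham : (b i : ℤ) + m.toAdd < 0 := ham
      omega
    · rfl
  · have hy : single z i (1 : F) ∈ B.comp a := by
      have := single_mem_Jdiag (b := b) z i (1 : F)
      rwa [hz, Nat.cast_zero, sub_zero] at this
    have hy' := hΨJ' a _ hy
    have key : ∀ t, Ψ (Γ₁.proj t (Ψ.symm (single z i 1))) * Γ₂.proj k (Ψ x) = 0 := by
      rintro ⟨c, h⟩
      by_cases hc : c = a
      · subst hc
        have h3 := Γ₁.proj_mem (a, h) (Ψ.symm (single z i 1))
        have h4 := hpos a h ha _ h3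
        have h5 := hpos _ _ ham _ (Γ₁.mul_mem _ _ _ h3 _ hx)
        rw [← Γ₂.proj_mul_left h4, ← map_mul]
        refine Γ₂.proj_of_mem_ne h5 fun he => hk ?_
        exact (mul_left_cancel (a := ((a, h) : Multiplicative ℤ × G)) he).symm
      · rw [h₁.proj_eq_zero hl hy' hc, map_zero, zero_mul]
    have h6 : single z i (1 : F) = ∑ t ∈ Γ₁.supp, Ψ (Γ₁.proj t (Ψ.symm (single z i 1))) := by
      rw [← map_sum, Γ₁.sum_proj, Ψ.apply_symm_apply]
    rw [h6, Finset.sum_mul]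
    exact Finset.sum_eq_zero fun t _ => key t

end Automorphisms

theorem stmt6 {F : Type*} [Field F] {G : Type*} [CommGroup G] {n s : ℕ}
    (nn : Fin s → ℕ) (hpos : ∀ i, 0 < nn i) (hn : n = ∑ i, nn i)
    (b : Fin n → Fin s) (hb : Monotone b)
    (hcard : ∀ i, (Finset.univ.filter fun k => b k = i).card = nn i) :
    -- restriction-and-coarsening descends to a well-defined injective map on
    -- admissible isomorphism classes…
    (∀ Γ₁ Γ₂ : AlgGrading F (Matrix (Fin n) (Fin n) F) (Multiplicative ℤ × G),
      Admissible b Γ₁ → Admissible b Γ₂ →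
        (AlgGrading.Iso Γ₁ Γ₂ ↔
          ∃ ψ : ↥(UTB F b) ≃ₐ[F] ↥(UTB F b),
            ∀ g : G, (inducedComp b Γ₁ g).map ψ.toLinearMap = inducedComp b Γ₂ g)) ∧
    -- …and is surjective onto the isomorphism classes of `G`-gradings on `U`.
    (∀ Δ : AlgGrading F (↥(UTB F b)) G,
      ∃ Γ : AlgGrading F (Matrix (Fin n) (Fin n) F) (Multiplicative ℤ × G),
        Admissible b Γ ∧
        ∃ ψ : ↥(UTB F b) ≃ₐ[F] ↥(UTB F b),
          ∀ g : G, (inducedComp b Γ g).map ψ.toLinearMap = Δ.comp g) := by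
  rcases n with _ | n
  · refine ⟨fun Γ₁ Γ₂ _ _ => ⟨fun _ => ⟨AlgEquiv.refl, fun g => Subsingleton.elim _ _⟩,
      fun _ => ⟨AlgEquiv.refl, fun g => Subsingleton.elim _ _⟩⟩, fun Δ => ?_⟩
    refine ⟨⟨fun _ => ⊥, fun _ => disjoint_bot_left, Subsingleton.elim _ _, ?_⟩,
      fun m _ => (Subsingleton.elim _ _ : _ = _).le, AlgEquiv.refl,
      fun g => Subsingleton.elim _ _⟩
    exact fun _ _ x _ y _ => (Submodule.mem_bot F).2 (Subsingleton.elim _ _)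
  · have hs : Function.Surjective b := fun i => by
      obtain ⟨k, hk⟩ := Finset.card_pos.1 ((hpos i).trans_eq (hcard i).symm)
      exact ⟨k, (Finset.mem_filter.1 hk).2⟩
    have hl : ∀ j, b j ≤ b (Fin.last n) := fun j => hb (Fin.le_last j)
    obtain ⟨z, hz⟩ := hs ⟨0, (Nat.zero_le _).trans_lt (b 0).isLt⟩
    exact ⟨fun Γ₁ Γ₂ h₁ h₂ => ⟨fun h => exists_inducedComp_equiv h₁ h₂ hl h,
      fun ⟨ψ, hψ⟩ => iso_of_inducedComp_equiv h₁ h₂ (congrArg Fin.val hz) hl ψ hψ⟩,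
      fun Δ => exists_admissible_lift hb hs hl Δ⟩
end

section
/- Let F be a field with char F = 0 or char F > 3, and let U = UT(n_1,…,n_s) ⊆ M_n(F) with n > 2. The associative algebra U admits an anti-automorphism if and only if n_i = n_{s−i+1} for all i = 1,…,⌊s/2⌋. -/
open Matrix
set_option synthInstance.maxHeartbeats 1000000
set_option maxHeartbeats 1000000

variable (F : Type*) [Field F] {n s : ℕ}

/-- A monotone map between finite chains is determined by the sizes of its fibres. -/
theorem Monotone.eq_of_card_fiber_eq {n s : ℕ} {b c : Fin n → Fin s} (hb : Monotone b)
    (hc : Monotone c)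
    (h : ∀ i, (Finset.univ.filter fun k => b k = i).card =
      (Finset.univ.filter fun k => c k = i).card) : b = c := by
  have hle : ∀ i, (Finset.univ.filter fun k => b k ≤ i).card =
      (Finset.univ.filter fun k => c k ≤ i).card := by
    intro i
    have key : ∀ d : Fin n → Fin s, (Finset.univ.filter fun k => d k ≤ i).card =
        ∑ j ∈ Finset.Iic i, (Finset.univ.filter fun k => d k = j).card := by
      intro d
      rw [Finset.card_eq_sum_card_fiberwise (f := d) (t := Finset.Iic i)]
      · refine Finset.sum_congr rfl fun j hj => congrArg _ ?_
        ext k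
        simp only [Finset.mem_filter, Finset.mem_univ, true_and, and_iff_right_iff_imp]
        rintro rfl
        exact Finset.mem_Iic.1 hj
      · intro k hk
        simpa using hk
    rw [key, key]
    exact Finset.sum_congr rfl fun j _ => h j
  have main : ∀ {d e : Fin n → Fin s}, Monotone d → Monotone e →
      (∀ i, (Finset.univ.filter fun k => d k ≤ i).card =
        (Finset.univ.filter fun k => e k ≤ i).card) → ∀ k, d k ≤ e k := by
    intro d e hd he hde k
    by_contra! hlt
    have hss : (Finset.univ.filter fun l => d l ≤ e k) ⊂
        (Finset.univ.filter fun l => e l ≤ e k) := by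
      refine Finset.ssubset_iff_of_subset ?_ |>.2 ⟨k, by simp, by simpa using hlt⟩
      intro l hl
      have hl : d l ≤ e k := by simpa using hl
      have hlk : l ≤ k := by
        by_contra! hkl
        exact absurd (hd hkl.le) (not_le.2 (hl.trans_lt hlt))
      simpa using he hlk
    exact absurd (hde (e k)) (Finset.card_lt_card hss).ne
  funext k
  exact le_antisymm (main hb hc hle k) (main hc hb (fun i => (hle i).symm) k)

theorem Module.Basis.finrank_eq_card_of_mem_iff {F V ι : Type*} [Field F] [AddCommGroup V]
    [Module F V] [Fintype ι] (v : Module.Basis ι F V) (S : Finset ι) (W : Submodule F V)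
    (hW : ∀ w, w ∈ W ↔ ∀ c ∉ S, v.repr w c = 0) : Module.finrank F W = S.card := by
  classical
  have hWS : W = Submodule.span F (Set.range fun c : S => v c) := by
    ext w
    have hr : (Set.range fun c : S => v c) = v '' (S : Set ι) := by
      ext
      simp
    rw [hW, hr, v.mem_span_image]
    constructor
    · intro h c hc
      by_contra hcS
      exact Finsupp.mem_support_iff.1 hc (h c hcS)
    · intro h c hc
      by_contra hne
      exact hc (h (Finsupp.mem_support_iff.2 hne))
  rw [hWS]
  exact (finrank_span_eq_card (v.linearIndependent.comp _ Subtype.val_injective)).trans (by simp)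

/-- `n` nonzero pairwise orthogonal idempotent matrices of size `n` are the coordinate
projections of some basis. -/
theorem Matrix.exists_basis_of_orthogonal_idempotents {F : Type*} [Field F] {n : ℕ}
    (g : Fin n → Matrix (Fin n) (Fin n) F) (hne : ∀ a, g a ≠ 0) (hid : ∀ a, g a * g a = g a)
    (horth : ∀ a c, a ≠ c → g a * g c = 0) :
    ∃ v : Module.Basis (Fin n) F (Fin n → F), ∀ c w, g c *ᵥ w = v.repr w c • v c := by
  have hex : ∀ a, ∃ w, g a *ᵥ w ≠ 0 := by
    intro a
    by_contra! h
    exact hne a (Matrix.ext_of_mulVec_single fun i => by simp only [h, Matrix.zero_mulVec])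
  choose u hu using hex
  have hgv : ∀ a c, g c *ᵥ (g a *ᵥ u a) = if c = a then g a *ᵥ u a else 0 := by
    intro a c
    rw [Matrix.mulVec_mulVec]
    split_ifs with h
    · rw [h, hid]
    · rw [horth c a h, Matrix.zero_mulVec]
  have hsum : ∀ (c : Fin n) (t : Fin n → F),
      g c *ᵥ (∑ a, t a • (g a *ᵥ u a)) = t c • (g c *ᵥ u c) := by
    intro c t
    simp [Matrix.mulVec_sum, Matrix.mulVec_smul, hgv]
  have hli : LinearIndependent F fun a => g a *ᵥ u a := by
    rw [Fintype.linearIndependent_iff]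
    intro t ht c
    have h := hsum c t
    rw [ht, Matrix.mulVec_zero] at h
    exact (smul_eq_zero.1 h.symm).resolve_right (hu c)
  cases isEmpty_or_nonempty (Fin n) with
  | inl h => exact ⟨Pi.basisFun F (Fin n), fun c => isEmptyElim c⟩
  | inr h =>
    refine ⟨basisOfLinearIndependentOfCardEqFinrank hli (by simp), fun c w => ?_⟩
    set v := basisOfLinearIndependentOfCardEqFinrank hli (by simp) with hv
    have hva : ∀ a, v a = g a *ᵥ u a := fun a => by simp [hv]
    conv_lhs => rw [← v.sum_repr w]
    simp only [hva]
    exact hsum c _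

theorem single_mem_UTB_s7 {F : Type*} [Field F] {n s : ℕ} {b : Fin n → Fin s} {p q : Fin n}
    (h : b p ≤ b q) (t : F) : Matrix.single p q t ∈ UTB F b := by
  intro i j hij
  rw [Matrix.single_apply, if_neg]
  rintro ⟨rfl, rfl⟩
  exact absurd h (not_le.2 hij)

/-- A nonzero subspace stable under the block-triangular matrices is a member of the
standard flag. -/
theorem exists_finrank_eq_of_UTB_stable {F : Type*} [Field F] {n s : ℕ} {b : Fin n → Fin s}
    (W : Submodule F (Fin n → F)) (hne : W ≠ ⊥)
    (hW : ∀ x ∈ UTB F b, ∀ w ∈ W, x *ᵥ w ∈ W) :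
    ∃ j, Module.finrank F W = (Finset.univ.filter fun k => b k ≤ j).card := by
  classical
  let T : Finset (Fin n) := Finset.univ.filter fun p => ∃ w ∈ W, w p ≠ 0
  have hT : T.Nonempty := by
    obtain ⟨w, hwW, hw⟩ := Submodule.exists_mem_ne_zero_of_ne_bot hne
    obtain ⟨p, hp⟩ := Function.ne_iff.1 hw
    exact ⟨p, by simpa [T] using ⟨w, hwW, hp⟩⟩
  obtain ⟨p, hpT, hmax⟩ := T.exists_max_image b hT
  obtain ⟨w, hwW, hwp⟩ : ∃ w ∈ W, w p ≠ 0 := by simpa [T] using hpT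
  have hsingle : ∀ q, b q ≤ b p → ∀ t : F, Pi.single q t ∈ W := by
    intro q hq t
    have h := hW _ (single_mem_UTB_s7 hq (t / w p)) w hwW
    rwa [Matrix.single_mulVec, div_mul_cancel₀ _ hwp] at h
  refine ⟨b p, (Pi.basisFun F (Fin n)).finrank_eq_card_of_mem_iff _ W fun x => ?_⟩
  simp only [Finset.mem_filter, Finset.mem_univ, true_and, Pi.basisFun_repr, not_le]
  constructor
  · intro hx c hc
    by_contra hxc
    exact absurd (hmax c (by simpa [T] using ⟨x, hx, hxc⟩)) (not_le.2 hc)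
  · intro hx
    rw [← Finset.univ_sum_single x]
    refine Submodule.sum_mem _ fun c _ => ?_
    rcases le_or_gt (b c) (b p) with h | h
    · exact hsingle c h _
    · rw [hx c h, Pi.single_zero]
      exact W.zero_mem

/-- The images under an anti-automorphism of the diagonal matrix units cut out a flag stable
under the block-triangular matrices. -/
theorem exists_card_ge_eq_card_le {F : Type*} [Field F] {n s : ℕ} {b : Fin n → Fin s}
    (hsurj : Function.Surjective b) (ψ : ↥(UTB F b) ≃ₗ[F] ↥(UTB F b))
    (hψ : ∀ x y, ψ (x * y) = ψ y * ψ x) (i : Fin s) :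
    ∃ j, (Finset.univ.filter fun k => i ≤ b k).card =
      (Finset.univ.filter fun k => b k ≤ j).card := by
  classical
  let e : Fin n → ↥(UTB F b) := fun a => ⟨Matrix.single a a 1, single_mem_UTB_s7 le_rfl 1⟩
  have hesum : ∑ a, e a = 1 := by
    apply Subtype.ext
    simp only [AddSubmonoidClass.coe_finsetSum, e, OneMemClass.coe_one]
    exact Matrix.sum_single_one
  have hψ1 : ψ 1 = 1 := by
    have h := hψ (ψ.symm 1) 1
    rwa [mul_one, ψ.apply_symm_apply, mul_one, eq_comm] at h
  have hzero : ∀ a c, b c < b a → ∀ x, ψ (e c) * x * ψ (e a) = 0 := by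
    intro a c hac x
    obtain ⟨y, rfl⟩ := ψ.surjective x
    rw [← hψ, ← hψ, ← map_zero ψ]
    congr 1
    apply Subtype.ext
    have hy : (y : Matrix (Fin n) (Fin n) F) a c = 0 := y.2 hac
    simp [e, ← mul_assoc, hy]
  have horth : ∀ a c, a ≠ c → e a * e c = 0 := fun a c h =>
    Subtype.ext (Matrix.single_mul_single_of_ne _ _ _ _ h _)
  have hid : ∀ a, e a * e a = e a := fun a => Subtype.ext (by simp [e])
  let g : Fin n → Matrix (Fin n) (Fin n) F := fun a => (ψ (e a) : Matrix (Fin n) (Fin n) F)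
  have hgsum : ∑ a, g a = 1 := by
    have h := congrArg (Subtype.val ∘ ψ) hesum
    simpa [hψ1, g] using h
  have hmul : ∀ a c, g a * g c = ((ψ (e c * e a) : ↥(UTB F b)) : Matrix (Fin n) (Fin n) F) :=
    fun a c => by rw [hψ]; rfl
  obtain ⟨v, hv⟩ := Matrix.exists_basis_of_orthogonal_idempotents g
    (fun a h => by
      have h0 : e a = 0 := by
        rw [← ψ.map_eq_zero_iff]
        exact Subtype.ext h
      have := congrFun (congrFun (congrArg Subtype.val h0) a) a
      simp [e] at this)
    (fun a => by rw [hmul, hid])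
    (fun a c h => by rw [hmul, horth c a h.symm, map_zero]; rfl)
  let W : Submodule F (Fin n → F) :=
    { carrier := {w | ∀ c, b c < i → g c *ᵥ w = 0}
      add_mem' := fun {x y} hx hy c hc => by rw [Matrix.mulVec_add, hx c hc, hy c hc, add_zero]
      zero_mem' := fun c _ => Matrix.mulVec_zero _
      smul_mem' := fun t x hx c hc => by rw [Matrix.mulVec_smul, hx c hc, smul_zero] }
  have hWrank : Module.finrank F W = (Finset.univ.filter fun k => i ≤ b k).card := by
    refine v.finrank_eq_card_of_mem_iff _ W fun w => ?_
    change (∀ c, b c < i → g c *ᵥ w = 0) ↔ _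
    simp [hv, v.ne_zero]
  have hWne : W ≠ ⊥ := by
    rw [← Submodule.one_le_finrank_iff, hWrank, Nat.one_le_iff_ne_zero, ← Nat.pos_iff_ne_zero,
      Finset.card_pos]
    obtain ⟨k, hk⟩ := hsurj i
    exact ⟨k, by simp [hk]⟩
  have hWst : ∀ x ∈ UTB F b, ∀ w ∈ W, x *ᵥ w ∈ W := by
    intro x hx w hw c hc
    rw [← Matrix.one_mulVec w, ← hgsum, Matrix.sum_mulVec, Matrix.mulVec_sum, Matrix.mulVec_sum]
    refine Finset.sum_eq_zero fun a _ => ?_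
    rcases lt_or_ge (b a) i with h | h
    · rw [hw a h, Matrix.mulVec_zero, Matrix.mulVec_zero]
    · have h0 : g c * x * g a = 0 :=
        congrArg Subtype.val (hzero a c (hc.trans_le h) ⟨x, hx⟩)
      rw [Matrix.mulVec_mulVec, Matrix.mulVec_mulVec, h0, Matrix.zero_mulVec]
  rw [← hWrank]
  exact exists_finrank_eq_of_UTB_stable W hWne hWst

/-- If every upper section of the fibres has the size of some lower section, then the sequence
of fibre sizes is a palindrome. -/
theorem card_fiber_rev_of_card_ge_eq_card_le {n s : ℕ} {b : Fin n → Fin s}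
    (hsurj : Function.Surjective b)
    (h : ∀ i, ∃ j, (Finset.univ.filter fun k => i ≤ b k).card =
      (Finset.univ.filter fun k => b k ≤ j).card) (i : Fin s) :
    (Finset.univ.filter fun k => b k = i).card =
      (Finset.univ.filter fun k => b k = i.rev).card := by
  choose f hf using h
  have hanti : StrictAnti f := by
    intro i j hij
    by_contra! hle
    have h1 : (Finset.univ.filter fun k => b k ≤ f i).card ≤
        (Finset.univ.filter fun k => b k ≤ f j).card :=
      Finset.card_le_card (Finset.monotone_filter_right _ fun k _ hk => hk.trans hle)
    have h2 : (Finset.univ.filter fun k => j ≤ b k) ⊂ (Finset.univ.filter fun k => i ≤ b k) := by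
      obtain ⟨k, hk⟩ := hsurj i
      refine Finset.ssubset_iff_of_subset ?_ |>.2 ⟨k, by simp [hk], by simpa [hk] using hij⟩
      exact Finset.monotone_filter_right _ fun k _ hk => hij.le.trans hk
    have h3 := Finset.card_lt_card h2
    rw [hf, hf] at h3
    exact absurd h1 (not_le.2 h3)
  have hmono : StrictMono fun i : Fin s => f i.rev := fun i j hij =>
    hanti (Fin.rev_lt_rev.2 hij)
  have hrev : ∀ i, f i.rev = i := fun i => by
    have hbij := Finite.injective_iff_surjective.1 hmono.injective
    exact congrFun ((hmono.range_inj strictMono_id).1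
      (by rw [hbij.range_eq, Set.range_id])) i
  have hle : ∀ i : Fin s, (Finset.univ.filter fun k => (b k).rev ≤ i).card =
      (Finset.univ.filter fun k => b k ≤ i).card := by
    intro i
    have h := hf i.rev
    rw [hrev] at h
    simpa only [Fin.rev_le_iff] using h
  have hlt : ∀ i : Fin s, (Finset.univ.filter fun k => (b k).rev < i).card =
      (Finset.univ.filter fun k => b k < i).card := by
    rintro ⟨_ | i, hi⟩
    · simp [Fin.lt_def]
    · simpa [Fin.lt_def, Fin.le_def, Nat.lt_succ_iff] using hle ⟨i, by omega⟩
  have hsplit : ∀ d : Fin n → Fin s, (Finset.univ.filter fun k => d k ≤ i).card =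
      (Finset.univ.filter fun k => d k < i).card + (Finset.univ.filter fun k => d k = i).card := by
    intro d
    rw [← Finset.card_union_of_disjoint]
    · congr 1
      ext k
      simp [le_iff_lt_or_eq]
    · exact Finset.disjoint_filter.2 fun k _ h => h.ne
  have h1 := hsplit b
  have h2 := hsplit fun k => (b k).rev
  have h3 := hle i
  have h4 := hlt i
  simp only [Fin.rev_eq_iff] at h2
  omega

/-- The flip along the secondary diagonal. -/
def UTB.flip {F : Type*} [Field F] {n s : ℕ} {b : Fin n → Fin s}
    (hrev : ∀ k, b k.rev = (b k).rev) : ↥(UTB F b) ≃ₗ[F] ↥(UTB F b) :=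
  LinearEquiv.ofInvolutive
    { toFun := fun x => ⟨(x : Matrix (Fin n) (Fin n) F)ᵀ.submatrix Fin.rev Fin.rev,
        fun i j hij => x.2 (by rw [hrev, hrev]; exact Fin.rev_lt_rev.2 hij)⟩
      map_add' := fun _ _ => rfl
      map_smul' := fun _ _ => rfl }
    fun x => Subtype.ext <| Matrix.ext fun i j => by
      change (x : Matrix (Fin n) (Fin n) F) i.rev.rev j.rev.rev = _
      rw [Fin.rev_rev, Fin.rev_rev]

theorem UTB.flip_mul {F : Type*} [Field F] {n s : ℕ} {b : Fin n → Fin s}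
    (hrev : ∀ k, b k.rev = (b k).rev) (x y : ↥(UTB F b)) :
    UTB.flip hrev (x * y) = UTB.flip hrev y * UTB.flip hrev x := by
  apply Subtype.ext
  change ((x : Matrix (Fin n) (Fin n) F) * (y : Matrix (Fin n) (Fin n) F))ᵀ.submatrix
      Fin.rev Fin.rev =
    (y : Matrix (Fin n) (Fin n) F)ᵀ.submatrix Fin.rev Fin.rev *
      (x : Matrix (Fin n) (Fin n) F)ᵀ.submatrix Fin.rev Fin.rev
  rw [Matrix.transpose_mul]
  exact (Matrix.submatrix_mul_equiv _ _ Fin.rev Fin.revPerm Fin.rev).symm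

theorem stmt7 {F : Type*} [Field F] {n s : ℕ}
    (nn : Fin s → ℕ) (hpos : ∀ i, 0 < nn i) (hn : n = ∑ i, nn i)
    (b : Fin n → Fin s) (hb : Monotone b)
    (hcard : ∀ i, (Finset.univ.filter fun k => b k = i).card = nn i)
    (hchar : ringChar F = 0 ∨ 3 < ringChar F) (hn2 : 2 < n) :
    (∃ ψ : ↥(UTB F b) ≃ₗ[F] ↥(UTB F b),
        ∀ x y : ↥(UTB F b), ψ (x * y) = ψ y * ψ x) ↔
      (∀ i : Fin s, nn i = nn i.rev) := by
  constructor
  · rintro ⟨ψ, hψ⟩ i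
    have hsurj : Function.Surjective b := by
      intro i
      have h := hpos i
      rw [← hcard, Finset.card_pos] at h
      obtain ⟨k, hk⟩ := h
      exact ⟨k, by simpa using hk⟩
    rw [← hcard, ← hcard]
    exact card_fiber_rev_of_card_ge_eq_card_le hsurj (exists_card_ge_eq_card_le hsurj ψ hψ) i
  · intro hsym
    have hb' : b = fun k => (b k.rev).rev := by
      refine hb.eq_of_card_fiber_eq (fun k l hkl => Fin.rev_le_rev.2 (hb (Fin.rev_le_rev.2 hkl)))
        fun i => ?_
      rw [hcard, hsym, ← hcard]
      refine Finset.card_bij (fun k _ => k.rev) ?_ (fun _ _ _ _ h => Fin.rev_injective h)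
        fun k hk => ⟨k.rev, ?_, Fin.rev_rev k⟩
      · intro k hk
        simpa [Fin.rev_eq_iff] using hk
      · simpa [Fin.rev_eq_iff] using hk
    have hrev : ∀ k, b k.rev = (b k).rev := fun k => by
      conv_rhs => rw [hb', Fin.rev_rev]
    exact ⟨UTB.flip hrev, UTB.flip_mul hrev⟩
end

section
/- Let G be a group and let L_1, L_2 be G-graded Lie algebras over a field. Suppose ψ: L_1 → L_2 is an isomorphism of (ungraded) Lie algebras that induces a G-graded isomorphism L_1/z(L_1) → L_2/z(L_2) between the quotients by the centers. Then ψ restricts to a G-graded isomorphism from the derived algebra L_1' = [L_1,L_1] onto L_2' = [L_2,L_2]. -/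
set_option synthInstance.maxHeartbeats 1000000
set_option maxHeartbeats 1000000

/-- The derived subalgebra `L' = [L,L]`, as a submodule. -/
def derivedSpan (F : Type*) [CommRing F] (L : Type*) [LieRing L] [LieAlgebra F L] :
    Submodule F L :=
  Submodule.span F {z : L | ∃ x y : L, z = ⁅x, y⁆}

section

variable {F : Type*} [CommRing F]
  {L₁ : Type*} [LieRing L₁] [LieAlgebra F L₁]
  {L₂ : Type*} [LieRing L₂] [LieAlgebra F L₂]
  {G : Type*} [Group G]

theorem lie_eq_lie_of_sub_mem_center {a b a' b' : L₁}
    (ha : a - a' ∈ LieAlgebra.center F L₁) (hb : b - b' ∈ LieAlgebra.center F L₁) :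
    ⁅a, b⁆ = ⁅a', b'⁆ := by
  rw [LieModule.mem_maxTrivSubmodule] at ha hb
  have h₁ : ⁅a, b - b'⁆ = 0 := hb a
  have h₂ : ⁅b', a - a'⁆ = 0 := ha b'
  rw [lie_sub, sub_eq_zero] at h₁ h₂
  rw [h₁, ← lie_skew, h₂, lie_skew]

/-- A Lie algebra homomorphism that preserves degrees modulo the center of the target preserves
degrees on the derived algebra. -/
theorem LieGrading.map_mem_comp_of_mem_derivedSpan
    (Γ₁ : LieGrading F L₁ G) (Γ₂ : LieGrading F L₂ G) (ψ : L₁ →ₗ⁅F⁆ L₂)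
    (hψ : ∀ g, ∀ x ∈ Γ₁.comp g, ∃ y ∈ Γ₂.comp g, ψ x - y ∈ LieAlgebra.center F L₂)
    {g : G} {x : L₁} (hx : x ∈ Γ₁.comp g) (hx' : x ∈ derivedSpan F L₁) :
    ψ x ∈ Γ₂.comp g := by
  let E : G → Submodule F L₁ := fun k => Γ₁.comp k ⊓ (Γ₂.comp k).comap (ψ : L₁ →ₗ[F] L₂)
  have hE : derivedSpan F L₁ ≤ ⨆ k, E k := by
    refine Submodule.span_le.2 ?_
    rintro _ ⟨a, b, rfl⟩
    have ha : a ∈ ⨆ k, Γ₁.comp k := Γ₁.total ▸ Submodule.mem_top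
    have hb : b ∈ ⨆ k, Γ₁.comp k := Γ₁.total ▸ Submodule.mem_top
    change ⁅a, b⁆ ∈ ⨆ k, E k
    induction ha using Submodule.iSup_induction' with
    | zero => simp
    | add u v _ _ hu hv => rw [add_lie]; exact add_mem hu hv
    | mem i u hu =>
      induction hb using Submodule.iSup_induction' with
      | zero => simp
      | add v w _ _ hv hw => rw [lie_add]; exact add_mem hv hw
      | mem j v hv =>
        obtain ⟨u', hu', hu''⟩ := hψ i u hu
        obtain ⟨v', hv', hv''⟩ := hψ j v hv
        refine Submodule.mem_iSup_of_mem (i * j) ⟨Γ₁.lie_mem i j u hu v hv, ?_⟩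
        change ψ ⁅u, v⁆ ∈ Γ₂.comp (i * j)
        rw [LieHom.map_lie, lie_eq_lie_of_sub_mem_center hu'' hv'']
        exact Γ₂.lie_mem i j u' hu' v' hv'
  have hsplit : ⨆ k, E k ≤ E g ⊔ ⨆ h, ⨆ _ : h ≠ g, E h := by
    refine iSup_le fun k => ?_
    by_cases hk : k = g
    · exact hk ▸ le_sup_left
    · exact le_sup_of_le_right (le_iSup₂_of_le k hk le_rfl)
  obtain ⟨e, he, r, hr, rfl⟩ := Submodule.mem_sup.1 (hsplit (hE hx'))
  have hr₁ : r ∈ Γ₁.comp g := (Submodule.add_mem_iff_right _ he.1).1 hx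
  have hr₂ : r ∈ ⨆ h, ⨆ _ : h ≠ g, Γ₁.comp h :=
    (iSup₂_mono fun _ _ => inf_le_left : _ ≤ ⨆ h, ⨆ _ : h ≠ g, Γ₁.comp h) hr
  rw [Submodule.disjoint_def.1 (Γ₁.indep g) r hr₁ hr₂, add_zero]
  exact he.2

theorem map_mem_derivedSpan (ψ : L₁ →ₗ⁅F⁆ L₂) {x : L₁} (hx : x ∈ derivedSpan F L₁) :
    ψ x ∈ derivedSpan F L₂ := by
  have h : derivedSpan F L₁ ≤ (derivedSpan F L₂).comap (ψ : L₁ →ₗ[F] L₂) := by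
    refine Submodule.span_le.2 ?_
    rintro _ ⟨a, b, rfl⟩
    exact Submodule.subset_span ⟨ψ a, ψ b, ψ.map_lie a b⟩
  exact h hx

theorem LieEquiv.symm_mem_center (ψ : L₁ ≃ₗ⁅F⁆ L₂) {z : L₂}
    (hz : z ∈ LieAlgebra.center F L₂) : ψ.symm z ∈ LieAlgebra.center F L₁ := by
  rw [LieModule.mem_maxTrivSubmodule] at hz ⊢
  intro x
  apply ψ.injective
  change ψ ⁅x, ψ.symm z⁆ = ψ 0
  rw [LieEquiv.map_lie, ψ.apply_symm_apply, hz, map_zero]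

end

theorem stmt18 {F : Type*} [Field F]
    {L₁ : Type*} [LieRing L₁] [LieAlgebra F L₁]
    {L₂ : Type*} [LieRing L₂] [LieAlgebra F L₂]
    {G : Type*} [Group G]
    (Γ₁ : LieGrading F L₁ G) (Γ₂ : LieGrading F L₂ G)
    (ψ : L₁ ≃ₗ⁅F⁆ L₂)
    -- `ψ` induces a `G`-graded isomorphism `L₁/z(L₁) → L₂/z(L₂)`:
    (hbar : ∃ ψbar : (L₁ ⧸ LieAlgebra.center F L₁) ≃ₗ⁅F⁆ (L₂ ⧸ LieAlgebra.center F L₂),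
      (∀ x : L₁, ψbar (LieSubmodule.Quotient.mk' (LieAlgebra.center F L₁) x) =
        LieSubmodule.Quotient.mk' (LieAlgebra.center F L₂) (ψ x)) ∧
      ∀ g : G,
        ((Γ₁.comp g).map
            (LieSubmodule.Quotient.mk' (LieAlgebra.center F L₁)).toLinearMap).map
          ψbar.toLinearEquiv.toLinearMap =
        (Γ₂.comp g).map
          (LieSubmodule.Quotient.mk' (LieAlgebra.center F L₂)).toLinearMap) :
    -- then `ψ` restricts to a `G`-graded isomorphism `L₁' → L₂'`:
    (derivedSpan F L₁).map ψ.toLinearEquiv.toLinearMap = derivedSpan F L₂ ∧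
    ∀ g : G, ((Γ₁.comp g) ⊓ derivedSpan F L₁).map ψ.toLinearEquiv.toLinearMap =
      (Γ₂.comp g) ⊓ derivedSpan F L₂ := by
  obtain ⟨ψbar, hψbar, hcomp⟩ := hbar
  have hto : ∀ g, ∀ x ∈ Γ₁.comp g, ∃ y ∈ Γ₂.comp g, ψ x - y ∈ LieAlgebra.center F L₂ := by
    intro g x hx
    obtain ⟨y, hy, hxy⟩ := (hcomp g).le
      (Submodule.mem_map_of_mem (Submodule.mem_map_of_mem hx))
    refine ⟨y, hy, (Submodule.Quotient.eq _).1 ?_⟩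
    exact (hψbar x).symm.trans hxy.symm
  have hinv : ∀ g, ∀ y ∈ Γ₂.comp g, ∃ x ∈ Γ₁.comp g,
      ψ.symm y - x ∈ LieAlgebra.center F L₁ := by
    intro g y hy
    obtain ⟨_, ⟨x, hx, rfl⟩, hxy⟩ := (hcomp g).ge (Submodule.mem_map_of_mem hy)
    have hmem : y - ψ x ∈ LieAlgebra.center F L₂ :=
      (Submodule.Quotient.eq _).1 (hxy.symm.trans (hψbar x))
    refine ⟨x, hx, ?_⟩
    have h := ψ.symm_mem_center hmem
    rwa [map_sub, ψ.symm_apply_apply] at h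
  refine ⟨le_antisymm ?_ fun y hy => ?_, fun g => le_antisymm ?_ fun y hy => ?_⟩
  · rintro _ ⟨x, hx, rfl⟩
    exact map_mem_derivedSpan ψ.toLieHom hx
  · exact ⟨ψ.symm y, map_mem_derivedSpan ψ.symm.toLieHom hy, ψ.apply_symm_apply y⟩
  · rintro _ ⟨x, ⟨hx, hx'⟩, rfl⟩
    exact ⟨Γ₁.map_mem_comp_of_mem_derivedSpan Γ₂ ψ.toLieHom hto hx hx',
      map_mem_derivedSpan ψ.toLieHom hx'⟩
  · exact ⟨ψ.symm y, ⟨Γ₂.map_mem_comp_of_mem_derivedSpan Γ₁ ψ.symm.toLieHom hinv hy.1 hy.2,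
      map_mem_derivedSpan ψ.symm.toLieHom hy.2⟩, ψ.apply_symm_apply y⟩
end

section
/- Let G be a group and let L_1, L_2 be G-graded Lie algebras over a field. Suppose there exists an isomorphism of (ungraded) Lie algebras ψ: L_1 → L_2 such that both the induced map L_1/z(L_1) → L_2/z(L_2) and the restriction z(L_1) → z(L_2) are G-graded isomorphisms. Then L_1 and L_2 are isomorphic as G-graded Lie algebras. -/
set_option synthInstance.maxHeartbeats 1000000
set_option maxHeartbeats 1000000

namespace LieGrading

variable {F : Type*} [Field F] {L : Type*} [LieRing L] [LieAlgebra F L] {G : Type*} [Group G]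

theorem isInternal [DecidableEq G] (Γ : LieGrading F L G) : DirectSum.IsInternal Γ.comp :=
  DirectSum.isInternal_submodule_of_iSupIndep_of_iSup_eq_top Γ.indep Γ.total

theorem induction (Γ : LieGrading F L G) {p : L → Prop}
    (hom : ∀ g, ∀ x ∈ Γ.comp g, p x) (add : ∀ x y, p x → p y → p (x + y)) (x : L) : p x :=
  Submodule.iSup_induction Γ.comp (motive := p) (Γ.total ▸ Submodule.mem_top : x ∈ ⨆ g, Γ.comp g)
    hom (hom 1 0 (zero_mem _)) add

/-- The homogeneous projections of a grading. A submodule containing every homogeneous component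
of an element contains that element. -/
theorem exists_proj (Γ : LieGrading F L G) : ∃ π : G → L →ₗ[F] L,
    (∀ g x, π g x ∈ Γ.comp g) ∧ (∀ g, ∀ x ∈ Γ.comp g, π g x = x) ∧
    (∀ g h, h ≠ g → ∀ x ∈ Γ.comp h, π g x = 0) ∧
    ∀ (N : Submodule F L) (x : L), (∀ g, π g x ∈ N) → x ∈ N := by
  classical
  let _ : DirectSum.Decomposition Γ.comp := Γ.isInternal.chooseDecomposition
  refine ⟨fun g => (Γ.comp g).subtype ∘ₗ DirectSum.component F G (fun g => Γ.comp g) g ∘ₗ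
    (DirectSum.decomposeLinearEquiv Γ.comp).toLinearMap, fun g x => Subtype.property _,
    fun g x hx => DirectSum.decompose_of_mem_same Γ.comp hx,
    fun g h hne x hx => DirectSum.decompose_of_mem_ne Γ.comp hx hne, fun N x hx => ?_⟩
  rw [← DirectSum.sum_support_decompose Γ.comp x]
  exact sum_mem fun g _ => hx g

/-- A family of linear maps glues to a linear map agreeing with them on homogeneous elements. -/
theorem exists_linearMap (Γ : LieGrading F L G) {M : Type*} [AddCommGroup M] [Module F M]
    (f : G → L →ₗ[F] M) : ∃ θ : L →ₗ[F] M, ∀ g, ∀ x ∈ Γ.comp g, θ x = f g x := by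
  classical
  let _ : DirectSum.Decomposition Γ.comp := Γ.isInternal.chooseDecomposition
  refine ⟨DirectSum.toModule F G M (fun g => f g ∘ₗ (Γ.comp g).subtype) ∘ₗ
    (DirectSum.decomposeLinearEquiv Γ.comp).toLinearMap, fun g x hx => ?_⟩
  lift x to Γ.comp g using hx
  simp

/-- The homogeneous components of a central element are central. -/
theorem proj_mem_center (Γ : LieGrading F L G) {π : G → L →ₗ[F] L}
    (same : ∀ g, ∀ x ∈ Γ.comp g, π g x = x)
    (ne : ∀ g h, h ≠ g → ∀ x ∈ Γ.comp h, π g x = 0)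
    {z : L} (hz : z ∈ LieAlgebra.center F L) (g : G) : π g z ∈ LieAlgebra.center F L := by
  have key : ∀ h, ∀ w ∈ Γ.comp h, ∀ x, π (g * h) ⁅x, w⁆ = ⁅π g x, w⁆ := by
    intro h w hw
    refine Γ.induction (fun k x hx => ?_) fun x y hx hy => by simp [hx, hy]
    have hxw := Γ.lie_mem k h x hx w hw
    by_cases hk : k = g
    · subst hk
      rw [same _ _ hxw, same _ _ hx]
    · rw [ne _ _ (fun e => hk (mul_right_cancel e)) _ hxw, ne _ _ hk _ hx, zero_lie]
  rw [LieModule.mem_maxTrivSubmodule] at hz ⊢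
  refine Γ.induction (fun h w hw => ?_) fun x y hx hy => by simp [hx, hy]
  rw [← lie_skew, ← key h w hw, ← lie_skew, hz, neg_zero, map_zero, neg_zero]

end LieGrading

theorem stmt19 {F : Type*} [Field F]
    {L₁ : Type*} [LieRing L₁] [LieAlgebra F L₁]
    {L₂ : Type*} [LieRing L₂] [LieAlgebra F L₂]
    {G : Type*} [Group G]
    (Γ₁ : LieGrading F L₁ G) (Γ₂ : LieGrading F L₂ G)
    (ψ : L₁ ≃ₗ⁅F⁆ L₂)
    -- the map induced by `ψ` on `L₁/z(L₁) → L₂/z(L₂)` is a `G`-graded isomorphism: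
    (hbar : ∃ ψbar : (L₁ ⧸ LieAlgebra.center F L₁) ≃ₗ⁅F⁆ (L₂ ⧸ LieAlgebra.center F L₂),
      (∀ x : L₁, ψbar (LieSubmodule.Quotient.mk' (LieAlgebra.center F L₁) x) =
        LieSubmodule.Quotient.mk' (LieAlgebra.center F L₂) (ψ x)) ∧
      ∀ g : G,
        ((Γ₁.comp g).map
            (LieSubmodule.Quotient.mk' (LieAlgebra.center F L₁)).toLinearMap).map
          ψbar.toLinearEquiv.toLinearMap =
        (Γ₂.comp g).map
          (LieSubmodule.Quotient.mk' (LieAlgebra.center F L₂)).toLinearMap)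
    -- the restriction of `ψ` to `z(L₁) → z(L₂)` is a `G`-graded isomorphism:
    (hz : ((LieAlgebra.center F L₁).toSubmodule).map ψ.toLinearEquiv.toLinearMap =
        (LieAlgebra.center F L₂).toSubmodule ∧
      ∀ g : G,
        ((Γ₁.comp g) ⊓ (LieAlgebra.center F L₁).toSubmodule).map
            ψ.toLinearEquiv.toLinearMap =
          (Γ₂.comp g) ⊓ (LieAlgebra.center F L₂).toSubmodule) :
    -- then `L₁` and `L₂` are isomorphic as `G`-graded Lie algebras:
    ∃ θ : L₁ ≃ₗ⁅F⁆ L₂,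
      ∀ g : G, (Γ₁.comp g).map θ.toLinearEquiv.toLinearMap = Γ₂.comp g := by
  obtain ⟨ψbar, hψbar, hgr⟩ := hbar
  obtain ⟨hzc, hzg⟩ := hz
  obtain ⟨π₁, mem₁, same₁, ne₁, total₁⟩ := Γ₁.exists_proj
  obtain ⟨π, mem, same, ne, -⟩ := Γ₂.exists_proj
  obtain ⟨θ, hθ⟩ := Γ₁.exists_linearMap fun g => π g ∘ₗ ψ.toLinearEquiv.toLinearMap
  have hθ' : ∀ g, ∀ x ∈ Γ₁.comp g, θ x = π g (ψ x) := hθ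
  have θ_mem : ∀ g, ∀ x ∈ Γ₁.comp g, θ x ∈ Γ₂.comp g := fun g x hx => hθ' g x hx ▸ mem g _
  have sub_mem_center : ∀ x, ψ x - θ x ∈ LieAlgebra.center F L₂ := by
    refine Γ₁.induction (fun g x hx => ?_) fun x y hx hy => ?_
    · obtain ⟨y, hy, hyx⟩ : ψbar (LieSubmodule.Quotient.mk' (LieAlgebra.center F L₁) x) ∈
          (Γ₂.comp g).map (LieSubmodule.Quotient.mk' (LieAlgebra.center F L₂)).toLinearMap :=
        hgr g ▸ Submodule.mem_map_of_mem (Submodule.mem_map_of_mem hx)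
      rw [hψbar] at hyx
      have hc : ψ x - y ∈ LieAlgebra.center F L₂ := by
        rw [← LieSubmodule.Quotient.mk_eq_zero, map_sub, sub_eq_zero]
        exact hyx.symm
      have e : ψ x - θ x = (ψ x - y) - π g (ψ x - y) := by
        rw [hθ' g x hx, map_sub, same g y hy]
        abel
      rw [e]
      exact sub_mem hc (Γ₂.proj_mem_center same ne hc g)
    · rw [map_add, map_add, add_sub_add_comm]
      exact add_mem hx hy
  have θ_center : ∀ x ∈ LieAlgebra.center F L₁, θ x = ψ x := by
    refine fun x hx => total₁ (LinearMap.eqLocus θ ψ.toLinearEquiv.toLinearMap) x fun g => ?_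
    have hc := Γ₁.proj_mem_center same₁ ne₁ hx g
    have hm : ψ (π₁ g x) ∈ Γ₂.comp g ⊓ (LieAlgebra.center F L₂).toSubmodule :=
      hzg g ▸ Submodule.mem_map_of_mem ⟨mem₁ g x, hc⟩
    exact (hθ' g _ (mem₁ g x)).trans (same g _ hm.1)
  have lie_θ : ∀ x y, ⁅θ x, θ y⁆ = ψ ⁅x, y⁆ := by
    intro x y
    have hx := sub_mem_center x
    have hy := sub_mem_center y
    rw [LieModule.mem_maxTrivSubmodule] at hx hy
    have h₁ : ⁅ψ x - θ x, ψ y⁆ = 0 := by rw [← lie_skew, hx, neg_zero]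
    have h₂ := hy (θ x)
    rw [sub_lie, sub_eq_zero] at h₁
    rw [lie_sub, sub_eq_zero] at h₂
    rw [← h₂, ← h₁, LieEquiv.map_lie]
  have map_lie : ∀ x y, θ ⁅x, y⁆ = ⁅θ x, θ y⁆ := by
    intro x y
    refine Γ₁.induction (p := fun x => θ ⁅x, y⁆ = ⁅θ x, θ y⁆) (fun g x hx => ?_)
      (fun _ _ h h' => by simp [h, h']) x
    refine Γ₁.induction (p := fun y => θ ⁅x, y⁆ = ⁅θ x, θ y⁆) (fun h y hy => ?_)
      (fun _ _ h h' => by simp [h, h']) y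
    rw [hθ' _ _ (Γ₁.lie_mem g h x hx y hy), ← lie_θ,
      same _ _ (Γ₂.lie_mem g h _ (θ_mem g x hx) _ (θ_mem h y hy))]
  have mem_center_iff : ∀ x, ψ x ∈ LieAlgebra.center F L₂ ↔ x ∈ LieAlgebra.center F L₁ := by
    intro x
    rw [← LieSubmodule.mem_toSubmodule, ← hzc]
    exact ψ.injective.mem_set_image
  have bij : Function.Bijective θ := by
    constructor
    · rw [injective_iff_map_eq_zero]
      intro x hx
      have hc := sub_mem_center x
      rw [hx, sub_zero, mem_center_iff] at hc
      rw [θ_center x hc] at hx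
      exact ψ.injective (hx.trans (map_zero ψ).symm)
    · intro y
      obtain ⟨x, rfl⟩ : ∃ x, ψ x = y := ψ.surjective y
      obtain ⟨w, hw⟩ : ∃ w, ψ w = ψ x - θ x := ψ.surjective _
      have hc := sub_mem_center x
      rw [← hw, mem_center_iff] at hc
      exact ⟨x + w, by rw [map_add, θ_center w hc, hw, add_sub_cancel]⟩
  refine ⟨LieEquiv.ofBijective { θ with map_lie' := map_lie _ _ } bij, fun g => ?_⟩
  refine le_antisymm (Submodule.map_le_iff_le_comap.2 (θ_mem g)) fun y hy => ?_
  obtain ⟨x, rfl⟩ := bij.2 y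
  have comm : ∀ x, θ (π₁ g x) = π g (θ x) := by
    refine Γ₁.induction (fun h x hx => ?_) fun x y hx hy => by simp [hx, hy]
    by_cases hg : h = g
    · subst hg
      rw [same₁ _ _ hx, same _ _ (θ_mem _ _ hx)]
    · rw [ne₁ _ _ hg _ hx, ne _ _ hg _ (θ_mem _ _ hx), map_zero]
  exact ⟨π₁ g x, mem₁ g x, (comm x).trans (same g _ hy)⟩
end
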